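/- arXiv:1409.6215 — 3 statements merged into one kernel-verified Lean document; each statement's English description precedes it below -/
import Mathlib

section
/- Let F = {f_1, …, f_k} (k ≥ 1) be a system of tropical polynomials in n variables over ℝ, let d_j = deg f_j, and set N = (n+2)(d_1 + ⋯ + d_k). Then F has a root in ℝ^n if and only if the Macaulay tropical linear system M_N ⊙ y of F has a solution. -/
open scoped Classical

/-- Exponent vectors in `n` variables. -/
abbrev Exp (n : ℕ) : Type := Fin n → ℕ

/-- The total degree `|I|` of an exponent vector. -/
def expDeg {n : ℕ} (I : Exp n) : ℕ := ∑ j, I j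

/-- A tropical polynomial: a finite nonempty support of exponent vectors
together with real coefficients. -/
structure TropPoly (n : ℕ) where
  supp : Finset (Exp n)
  supp_nonempty : supp.Nonempty
  coeff : Exp n → ℝ

/-- The degree of a tropical polynomial. -/
def TropPoly.deg {n : ℕ} (f : TropPoly n) : ℕ := f.supp.sup expDeg

/-- Value of the monomial of `f` with exponent `I` at a point of `ℝ^n`. -/
def TropPoly.mono {n : ℕ} (f : TropPoly n) (I : Exp n) (a : Fin n → ℝ) : ℝ :=
  f.coeff I + ∑ j, (I j : ℝ) * a j

/-- Value of a tropical polynomial at a point of `ℝ^n`. -/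
def TropPoly.eval {n : ℕ} (f : TropPoly n) (a : Fin n → ℝ) : ℝ :=
  f.supp.inf' f.supp_nonempty (fun I => f.mono I a)

/-- A point of `ℝ^n` is a root if the minimum is attained at two distinct monomials. -/
def TropPoly.IsRoot {n : ℕ} (f : TropPoly n) (a : Fin n → ℝ) : Prop :=
  ∃ I ∈ f.supp, ∃ J ∈ f.supp, I ≠ J ∧
    f.mono I a = f.eval a ∧ f.mono J a = f.eval a

/-- Value of the monomial of `f` with exponent `I` at a point of `ℝ∞^n`
(with the convention `0 • ⊤ = 0`). -/
noncomputable def TropPoly.monoT {n : ℕ} (f : TropPoly n) (I : Exp n)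
    (a : Fin n → WithTop ℝ) : WithTop ℝ :=
  (f.coeff I : WithTop ℝ) + ∑ j, (I j) • a j

/-- Value of a tropical polynomial at a point of `ℝ∞^n`. -/
noncomputable def TropPoly.evalT {n : ℕ} (f : TropPoly n) (a : Fin n → WithTop ℝ) : WithTop ℝ :=
  f.supp.inf (fun I => f.monoT I a)

/-- A point of `ℝ∞^n` is a root if the minimum is `+∞` or is attained at two
distinct monomials. -/
noncomputable def TropPoly.IsRootT {n : ℕ} (f : TropPoly n) (a : Fin n → WithTop ℝ) : Prop :=
  f.evalT a = ⊤ ∨ ∃ I ∈ f.supp, ∃ J ∈ f.supp, I ≠ J ∧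
    f.monoT I a = f.evalT a ∧ f.monoT J a = f.evalT a

/-- The coefficient of the monomial `x^I` in `x^J ⊙ f`, which is `+∞`
unless `I - J` belongs to the support of `f`. -/
noncomputable def shiftCoeff {n : ℕ} (f : TropPoly n) (J I : Exp n) : WithTop ℝ :=
  if J ≤ I ∧ I - J ∈ f.supp then (f.coeff (I - J) : WithTop ℝ) else ⊤

/-- The entry `c_{f}(I-J) + y_I` of the Macaulay system. -/
noncomputable def macVal {n : ℕ} (f : TropPoly n) (J : Exp n)
    (y : Exp n → WithTop ℝ) (I : Exp n) : WithTop ℝ :=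
  shiftCoeff f J I + y I

/-- `y` is a solution of the Macaulay tropical linear system `M_N ⊙ y` of `F` over `ℝ`:
for every `j` and every `J` with `|J| + deg f_j ≤ N`, the minimum over all `I` with
`|I| ≤ N` of `c_{f_j}(I-J) + y_I` is attained for at least two distinct `I`. -/
noncomputable def IsMacaulaySol {n k : ℕ} (F : Fin k → TropPoly n) (N : ℕ)
    (y : Exp n → ℝ) : Prop :=
  ∀ j : Fin k, ∀ J : Exp n, expDeg J + (F j).deg ≤ N →
    ∃ I₁ I₂ : Exp n, I₁ ≠ I₂ ∧ expDeg I₁ ≤ N ∧ expDeg I₂ ≤ N ∧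
      macVal (F j) J (fun I => (y I : WithTop ℝ)) I₁ =
        macVal (F j) J (fun I => (y I : WithTop ℝ)) I₂ ∧
      ∀ I : Exp n, expDeg I ≤ N →
        macVal (F j) J (fun I => (y I : WithTop ℝ)) I₁ ≤
          macVal (F j) J (fun I => (y I : WithTop ℝ)) I

namespace TropAux

variable {n : ℕ}

/-- The standard pairing. -/
def dot (x b : Fin n → ℝ) : ℝ := ∑ l, x l * b l

/-- An exponent vector as a real vector. -/
def toR (I : Exp n) : Fin n → ℝ := fun l => (I l : ℝ)

lemma dot_add_left (x y b : Fin n → ℝ) : dot (x + y) b = dot x b + dot y b := by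
  simp [dot, add_mul, Finset.sum_add_distrib]

lemma dot_sub_left (x y b : Fin n → ℝ) : dot (x - y) b = dot x b - dot y b := by
  simp [dot, sub_mul, Finset.sum_sub_distrib]

lemma dot_add_right (x y b : Fin n → ℝ) : dot x (y + b) = dot x y + dot x b := by
  simp [dot, mul_add, Finset.sum_add_distrib]

lemma dot_smul_right (x : Fin n → ℝ) (t : ℝ) (b : Fin n → ℝ) : dot x (t • b) = t * dot x b := by
  simp only [dot, Finset.mul_sum, Pi.smul_apply, smul_eq_mul]
  exact Finset.sum_congr rfl fun _ _ => by ring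

lemma continuous_dot (x : Fin n → ℝ) : Continuous (dot x) := by
  unfold dot; fun_prop

lemma toR_add (I J : Exp n) : toR (I + J) = toR I + toR J := by
  ext l; simp [toR]

lemma dot_toR_one (I : Exp n) : dot (toR I) (fun _ => 1) = (expDeg I : ℝ) := by
  simp [dot, toR, expDeg]

lemma mono_eq (f : TropPoly n) (I : Exp n) (a : Fin n → ℝ) :
    f.mono I a = f.coeff I + dot (toR I) a := rfl

lemma eval_le (f : TropPoly n) {I : Exp n} (hI : I ∈ f.supp) (a : Fin n → ℝ) :
    f.eval a ≤ f.mono I a := Finset.inf'_le _ hI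

lemma le_eval (f : TropPoly n) (a : Fin n → ℝ) {c : ℝ} (h : ∀ I ∈ f.supp, c ≤ f.mono I a) :
    c ≤ f.eval a := Finset.le_inf' _ _ h

lemma exists_eval (f : TropPoly n) (a : Fin n → ℝ) : ∃ I ∈ f.supp, f.eval a = f.mono I a :=
  Finset.exists_mem_eq_inf' _ _

lemma continuous_mono (f : TropPoly n) (I : Exp n) : Continuous (f.mono I) :=
  continuous_const.add (continuous_dot _)

lemma continuous_eval (f : TropPoly n) : Continuous f.eval := by
  unfold TropPoly.eval
  exact Continuous.finset_inf'_apply _ fun I _ => continuous_mono f I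

lemma concave_eval (f : TropPoly n) : ConcaveOn ℝ Set.univ f.eval := by
  refine ⟨convex_univ, fun x _ y _ s t hs ht hst => le_eval f _ fun I hI => ?_⟩
  have h1 := mul_le_mul_of_nonneg_left (eval_le f hI x) hs
  have h2 := mul_le_mul_of_nonneg_left (eval_le f hI y) ht
  rw [mono_eq] at *
  rw [dot_add_right, dot_smul_right, dot_smul_right]
  simp only [smul_eq_mul]
  have : f.coeff I = s * f.coeff I + t * f.coeff I := by rw [← add_mul, hst, one_mul]
  linarith

lemma eval_mono (f : TropPoly n) {a b : Fin n → ℝ} (h : a ≤ b) : f.eval a ≤ f.eval b := by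
  refine le_eval f _ fun I hI => (eval_le f hI a).trans ?_
  unfold TropPoly.mono
  gcongr with l
  exact h l

lemma eval_sub (f : TropPoly n) (a : Fin n → ℝ) {t : ℝ} (ht : 0 ≤ t) :
    f.eval a - f.deg * t ≤ f.eval (a + (-t) • (fun _ => (1 : ℝ))) := by
  refine le_eval f _ fun I hI => ?_
  have h1 := eval_le f hI a
  have h2 : (expDeg I : ℝ) ≤ f.deg := by
    exact_mod_cast Finset.le_sup (f := expDeg) hI
  rw [mono_eq] at *
  rw [dot_add_right, dot_smul_right, dot_toR_one]
  nlinarith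

lemma exists_unique_of_not_root (f : TropPoly n) (a : Fin n → ℝ) (h : ¬ f.IsRoot a) :
    ∃ I ∈ f.supp, f.eval a = f.mono I a ∧ ∀ J ∈ f.supp, J ≠ I → f.eval a < f.mono J a := by
  obtain ⟨I, hI, hIa⟩ := exists_eval f a
  refine ⟨I, hI, hIa, fun J hJ hne => lt_of_le_of_ne (eval_le f hJ a) fun he => h ?_⟩
  exact ⟨I, hI, J, hJ, hne.symm, hIa.symm, he.symm⟩

lemma eventually_eval (f : TropPoly n) (a : Fin n → ℝ) {I : Exp n} (hI : I ∈ f.supp)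
    (ha : f.eval a = f.mono I a) (h : ∀ J ∈ f.supp, J ≠ I → f.eval a < f.mono J a) :
    ∀ᶠ b in nhds a, f.eval b = f.mono I b := by
  have : ∀ᶠ b in nhds a, ∀ J ∈ f.supp, f.mono I b ≤ f.mono J b := by
    rw [Filter.eventually_all_finset]
    intro J hJ
    by_cases hne : J = I
    · subst hne; exact Filter.Eventually.of_forall fun _ => le_rfl
    · have h1 := h J hJ hne
      rw [ha] at h1
      exact ((continuous_mono f I).continuousAt.eventually_lt
        (continuous_mono f J).continuousAt h1).mono fun _ h => h.le
  filter_upwards [this] with b hb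
  exact le_antisymm (eval_le f hI b) (le_eval f b hb)

/-! The strictly concave regularizer. -/

lemma sqrt_lip (x t : ℝ) : |√(1 + (x + t) ^ 2) - √(1 + x ^ 2)| ≤ |t| := by
  have h1 : 0 ≤ √(1 + (x + t) ^ 2) := Real.sqrt_nonneg _
  have h2 : 0 ≤ √(1 + x ^ 2) := Real.sqrt_nonneg _
  have e1 : √(1 + (x + t) ^ 2) ^ 2 = 1 + (x + t) ^ 2 := Real.sq_sqrt (by positivity)
  have e2 : √(1 + x ^ 2) ^ 2 = 1 + x ^ 2 := Real.sq_sqrt (by positivity)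
  generalize √(1 + (x + t) ^ 2) = u at *
  generalize √(1 + x ^ 2) = v at *
  rw [← sq_le_sq]
  have h3 : 1 + x * (x + t) ≤ u * v := by
    refine le_trans (le_abs_self _) (abs_le_of_sq_le_sq ?_ (mul_nonneg h1 h2))
    rw [mul_pow, e1, e2]
    nlinarith [sq_nonneg t]
  nlinarith

lemma sqrt_strictConvex : StrictConvexOn ℝ Set.univ (fun x : ℝ => √(1 + x ^ 2)) := by
  refine ⟨convex_univ, fun x _ y _ hxy s t hs ht hst => ?_⟩
  simp only [smul_eq_mul]
  have h1 : 0 ≤ √(1 + x ^ 2) := Real.sqrt_nonneg _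
  have h2 : 0 ≤ √(1 + y ^ 2) := Real.sqrt_nonneg _
  have e1 : √(1 + x ^ 2) ^ 2 = 1 + x ^ 2 := Real.sq_sqrt (by positivity)
  have e2 : √(1 + y ^ 2) ^ 2 = 1 + y ^ 2 := Real.sq_sqrt (by positivity)
  generalize √(1 + x ^ 2) = u at *
  generalize √(1 + y ^ 2) = v at *
  have h3 : 1 + x * y < u * v := by
    apply lt_of_pow_lt_pow_left₀ 2 (mul_nonneg h1 h2)
    rw [mul_pow, e1, e2]
    have : 0 < (x - y) ^ 2 := by
      have := sub_ne_zero.2 hxy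
      positivity
    nlinarith
  rw [Real.sqrt_lt' (by
    have hu : 0 < u := by nlinarith [sq_nonneg x]
    positivity)]
  have h4 : 0 < s * t := mul_pos hs ht
  have h5 : 1 = s ^ 2 + 2 * (s * t) + t ^ 2 := by
    rw [← one_pow 2, ← hst]; ring
  nlinarith [mul_lt_mul_of_pos_left h3 h4]

/-- The regularizer. -/
noncomputable def psi (n : ℕ) (b : Fin n → ℝ) : ℝ := ∑ l, (b l - ((n : ℝ) + 1)⁻¹ * √(1 + (b l) ^ 2))

lemma continuous_psi : Continuous (psi n) := by
  unfold psi; fun_prop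

lemma r_pos : (0 : ℝ) < ((n : ℝ) + 1)⁻¹ := by positivity

lemma r_le : ((n : ℝ) + 1)⁻¹ ≤ 1 := inv_le_one_of_one_le₀ (by linarith [n.cast_nonneg (α := ℝ)])

lemma strictConcave_psi : StrictConcaveOn ℝ Set.univ (psi n) := by
  refine ⟨convex_univ, fun x _ y _ hxy s t hs ht hst => ?_⟩
  simp only [smul_eq_mul, psi, Finset.mul_sum, ← Finset.sum_add_distrib]
  have hr := r_pos (n := n)
  obtain ⟨l, hl⟩ := Function.ne_iff.1 hxy
  refine Finset.sum_lt_sum (fun i _ => ?_) ⟨l, Finset.mem_univ _, ?_⟩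
  · have := sqrt_strictConvex.convexOn.2 (Set.mem_univ (x i)) (Set.mem_univ (y i)) hs.le ht.le hst
    simp only [smul_eq_mul] at this
    have := mul_le_mul_of_nonneg_left this hr.le
    simp only [Pi.add_apply, Pi.smul_apply, smul_eq_mul]
    linarith
  · have := sqrt_strictConvex.2 (Set.mem_univ (x l)) (Set.mem_univ (y l)) hl hs ht hst
    simp only [smul_eq_mul] at this
    have := mul_lt_mul_of_pos_left this hr
    simp only [Pi.add_apply, Pi.smul_apply, smul_eq_mul]
    linarith

lemma psi_mono {a b : Fin n → ℝ} (h : a ≤ b) : psi n a ≤ psi n b := by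
  unfold psi
  refine Finset.sum_le_sum fun l _ => ?_
  have h1 := sqrt_lip (a l) (b l - a l)
  have h2 : 0 ≤ b l - a l := sub_nonneg.2 (h l)
  rw [abs_of_nonneg h2, add_sub_cancel] at h1
  have h3 := (abs_le.1 h1).2
  have := mul_le_mul_of_nonneg_left h3 (r_pos (n := n)).le
  have := mul_le_mul_of_nonneg_right (r_le (n := n)) h2
  linarith

lemma psi_sub (a : Fin n → ℝ) {t : ℝ} (ht : 0 ≤ t) :
    psi n a - (n + 1) * t ≤ psi n (a + (-t) • (fun _ => (1 : ℝ))) := by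
  have key : ∀ l, a l - ((n : ℝ) + 1)⁻¹ * √(1 + (a l) ^ 2) - (1 + ((n : ℝ) + 1)⁻¹) * t ≤
      a l + -t - ((n : ℝ) + 1)⁻¹ * √(1 + (a l + -t) ^ 2) := by
    intro l
    have h1 := sqrt_lip (a l) (-t)
    rw [abs_neg, abs_of_nonneg ht] at h1
    have := mul_le_mul_of_nonneg_left (abs_le.1 h1).2 (r_pos (n := n)).le
    linarith
  have := Finset.sum_le_sum fun l (_ : l ∈ Finset.univ) => key l
  rw [Finset.sum_sub_distrib] at this
  simp only [Finset.sum_const, Finset.card_univ, Fintype.card_fin, nsmul_eq_mul] at this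
  have h2 : (n : ℝ) * ((1 + ((n : ℝ) + 1)⁻¹) * t) ≤ (n + 1) * t := by
    have : (n : ℝ) * (((n : ℝ) + 1)⁻¹) ≤ 1 := by
      rw [← div_eq_mul_inv, div_le_one (by positivity)]; linarith
    nlinarith
  simp only [psi, Pi.add_apply, Pi.smul_apply, smul_eq_mul, mul_one]
  linarith

/-- A strictly concave function with a maximum is coercive. -/
lemma exists_max_of_le {G h : (Fin n → ℝ) → ℝ} (hG : StrictConcaveOn ℝ Set.univ G)
    (hGc : Continuous G) (hhc : Continuous h) {a : Fin n → ℝ} (ha : ∀ b, G b ≤ G a)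
    {C : ℝ} (hC : ∀ b, h b ≤ C) : ∃ c, ∀ b, G b + h b ≤ G c + h c := by
  have hlt : ∀ b, b ≠ a → G b < G a := by
    intro b hb
    refine lt_of_le_of_ne (ha b) fun he => hb ?_
    exact hG.eq_of_isMaxOn (fun x _ => by simpa [he] using ha x) (fun x _ => ha x)
      (Set.mem_univ _) (Set.mem_univ _)
  obtain ⟨ε, hε, hs⟩ : ∃ ε > 0, ∀ b ∈ Metric.sphere a 1, G b ≤ G a - ε := by
    rcases (Metric.sphere a 1).eq_empty_or_nonempty with he | hne
    · exact ⟨1, one_pos, fun b hb => by simp [he] at hb⟩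
    · obtain ⟨m, hm, hmax⟩ := (isCompact_sphere a 1).exists_isMaxOn hne hGc.continuousOn
      refine ⟨G a - G m, sub_pos.2 (hlt m ?_), fun b hb => ?_⟩
      · rintro rfl; simp at hm
      · have : G b ≤ G m := hmax hb
        linarith
  have hlin : ∀ b, 1 ≤ dist b a → G b ≤ G a - ε * dist b a := by
    intro b hb
    set d := dist b a with hd
    have hd0 : 0 < d := by linarith
    have hinv : d⁻¹ ≤ 1 := inv_le_one_of_one_le₀ hb
    have hc := hG.concaveOn.2 (Set.mem_univ a) (Set.mem_univ b) (show 0 ≤ 1 - d⁻¹ by linarith)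
      (show 0 ≤ d⁻¹ by positivity) (by ring)
    have hmem : (1 - d⁻¹) • a + d⁻¹ • b ∈ Metric.sphere a 1 := by
      have : (1 - d⁻¹) • a + d⁻¹ • b - a = d⁻¹ • (b - a) := by
        rw [sub_smul, smul_sub, one_smul]; abel
      rw [mem_sphere_iff_norm, this, norm_smul, ← dist_eq_norm, ← hd, Real.norm_eq_abs,
        abs_of_pos (by positivity), inv_mul_cancel₀ hd0.ne']
    have := hc.trans (hs _ hmem)
    simp only [smul_eq_mul] at this
    have h2 : d⁻¹ * (G b - G a) ≤ -ε := by linarith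
    have h3 := mul_le_mul_of_nonneg_left h2 hd0.le
    rw [← mul_assoc, mul_inv_cancel₀ hd0.ne', one_mul] at h3
    linarith
  set R := max 1 ((C - h a) / ε) with hR
  have hR0 : 0 ≤ R := zero_le_one.trans (le_max_left _ _)
  obtain ⟨c, _, hcmax⟩ := (isCompact_closedBall a R).exists_isMaxOn
    ⟨a, Metric.mem_closedBall_self hR0⟩ ((hGc.add hhc).continuousOn)
  have hca : G a + h a ≤ G c + h c := hcmax (Metric.mem_closedBall_self hR0)
  refine ⟨c, fun b => ?_⟩
  by_cases hb : b ∈ Metric.closedBall a R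
  · exact hcmax hb
  · rw [Metric.mem_closedBall, not_le] at hb
    have h1 := hlin b ((le_max_left _ _).trans hb.le)
    have h2 : (C - h a) / ε ≤ dist b a := (le_max_right _ _).trans hb.le
    rw [div_le_iff₀ hε] at h2
    have := hC b
    linarith

/-- bounds on the slope at a maximum -/
lemma slope_bounds {Φ : (Fin n → ℝ) → ℝ} {D : ℝ} (hm : ∀ a b, a ≤ b → Φ a ≤ Φ b)
    (hD : ∀ a t, 0 ≤ t → Φ a - D * t ≤ Φ (a + (-t) • (fun _ => (1 : ℝ))))
    (x a : Fin n → ℝ) (ha : ∀ b, Φ b - dot x b ≤ Φ a - dot x a) :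
    (∀ l, 0 ≤ x l) ∧ dot x (fun _ => 1) ≤ D := by
  constructor
  · intro l
    have h1 := ha (a + Pi.single l 1)
    have h2 := hm a (a + Pi.single l 1) (le_add_of_nonneg_right (by simp))
    rw [dot_add_right] at h1
    have h3 : dot x (Pi.single l 1) = x l := by simp [dot, Pi.single_apply]
    linarith
  · have h1 := ha (a + (-1 : ℝ) • (fun _ => (1 : ℝ)))
    have h2 := hD a 1 zero_le_one
    rw [dot_add_right, dot_smul_right] at h1
    linarith

/-- Partial sums of the `f_j` plus the regularizer. -/
noncomputable def Phi {k : ℕ} (F : Fin k → TropPoly n) (s : Finset (Fin k)) (b : Fin n → ℝ) : ℝ :=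
  (∑ i ∈ s, (F i).eval b) + psi n b

lemma Phi_mono {k : ℕ} (F : Fin k → TropPoly n) (s : Finset (Fin k)) (a b : Fin n → ℝ)
    (h : a ≤ b) : Phi F s a ≤ Phi F s b :=
  add_le_add (Finset.sum_le_sum fun i _ => eval_mono (F i) h) (psi_mono h)

lemma Phi_sub {k : ℕ} (F : Fin k → TropPoly n) (s : Finset (Fin k)) (a : Fin n → ℝ) (t : ℝ)
    (ht : 0 ≤ t) : Phi F s a - ((∑ i ∈ s, ((F i).deg : ℝ)) + (n + 1)) * t ≤
      Phi F s (a + (-t) • (fun _ => (1 : ℝ))) := by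
  have h1 := psi_sub a ht
  have h2 := Finset.sum_le_sum fun i (_ : i ∈ s) => eval_sub (F i) a ht
  rw [Finset.sum_sub_distrib, ← Finset.sum_mul] at h2
  unfold Phi
  linarith

lemma continuous_Phi {k : ℕ} (F : Fin k → TropPoly n) (s : Finset (Fin k)) :
    Continuous (Phi F s) :=
  (continuous_finsetSum _ fun i _ => continuous_eval (F i)).add continuous_psi

lemma strictConcave_Phi_sub {k : ℕ} (F : Fin k → TropPoly n) (s : Finset (Fin k))
    (x : Fin n → ℝ) : StrictConcaveOn ℝ Set.univ (fun b => Phi F s b - dot x b) := by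
  refine ⟨convex_univ, fun u _ v _ huv p q hp hq hpq => ?_⟩
  have h1 := strictConcave_psi.2 (Set.mem_univ u) (Set.mem_univ v) huv hp hq hpq
  have h2 := Finset.sum_le_sum fun i (_ : i ∈ s) =>
    (concave_eval (F i)).2 (Set.mem_univ u) (Set.mem_univ v) hp.le hq.le hpq
  simp only [smul_eq_mul, Finset.sum_add_distrib, ← Finset.mul_sum] at h1 h2
  simp only [Phi, smul_eq_mul, dot_add_right, dot_smul_right]
  linarith

/-- The admissible lattice points. -/
def IsMaxAt {k : ℕ} (F : Fin k → TropPoly n) (p : Exp n) (a : Fin n → ℝ) : Prop :=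
  ∀ b, Phi F Finset.univ b - dot (toR p) b ≤ Phi F Finset.univ a - dot (toR p) a

lemma exists_isMaxAt {k : ℕ} (F : Fin k → TropPoly n) : ∃ p a, IsMaxAt F p a := by
  choose I hI using fun j => (F j).supp_nonempty
  have h0 : ∀ b : Fin n → ℝ, Phi F ∅ b - dot (toR 1) b ≤
      Phi F ∅ (0 : Fin n → ℝ) - dot (toR 1) (0 : Fin n → ℝ) := by
    intro b
    have : ∀ b : Fin n → ℝ, Phi F ∅ b - dot (toR 1) b =
        - ∑ l, ((n : ℝ) + 1)⁻¹ * √(1 + (b l) ^ 2) := by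
      intro b
      simp [Phi, psi, dot, toR]
    rw [this, this]
    refine neg_le_neg (Finset.sum_le_sum fun l _ => mul_le_mul_of_nonneg_left ?_ r_pos.le)
    apply Real.sqrt_le_sqrt
    simp [sq_nonneg]
  obtain ⟨c, hc⟩ := exists_max_of_le (strictConcave_Phi_sub F ∅ (toR 1))
    ((continuous_Phi F ∅).sub (continuous_dot _))
    (h := fun b => ∑ j, ((F j).eval b - dot (toR (I j)) b))
    (continuous_finsetSum _ fun i _ => (continuous_eval (F i)).sub (continuous_dot _))
    h0 (C := ∑ j, (F j).coeff (I j)) (fun b => Finset.sum_le_sum fun j _ => by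
      have := eval_le (F j) (hI j) b
      rw [mono_eq] at this
      linarith)
  refine ⟨1 + ∑ j, I j, c, fun b => ?_⟩
  have e : ∀ b, Phi F Finset.univ b - dot (toR (1 + ∑ j, I j)) b =
      Phi F ∅ b - dot (toR 1) b + ∑ j, ((F j).eval b - dot (toR (I j)) b) := by
    intro b
    have : dot (toR (∑ j, I j)) b = ∑ j, dot (toR (I j)) b := by
      simp only [dot, toR, Finset.sum_apply, Nat.cast_sum, Finset.sum_mul]
      exact Finset.sum_comm
    rw [toR_add, dot_add_left, this, Finset.sum_sub_distrib]
    simp only [Phi, Finset.sum_empty]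
    ring
  rw [e, e]
  exact hc b

lemma IsMaxAt.deg_le {k : ℕ} {F : Fin k → TropPoly n} {p : Exp n} {a : Fin n → ℝ}
    (h : IsMaxAt F p a) : expDeg p ≤ ∑ j, (F j).deg + (n + 1) := by
  have := (slope_bounds (Phi_mono F Finset.univ) (Phi_sub F Finset.univ) (toR p) a h).2
  rw [dot_toR_one] at this
  exact_mod_cast this

lemma finite_deg (N : ℕ) : {p : Exp n | expDeg p ≤ N}.Finite := by
  refine (Set.finite_Iic (fun _ : Fin n => N)).subset fun p hp l => ?_
  exact (Finset.single_le_sum (f := p) (fun _ _ => Nat.zero_le _) (Finset.mem_univ l)).trans hp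

lemma no_solution {k : ℕ} (F : Fin k → TropPoly n) {N : ℕ}
    (hN : ∑ j, (F j).deg + (n + 1) ≤ N)
    (hF : ¬ ∃ a : Fin n → ℝ, ∀ j : Fin k, (F j).IsRoot a) (y : Exp n → ℝ) :
    ¬ IsMacaulaySol F N y := by
  intro hy
  push Not at hF
  obtain ⟨p0, a0, h0⟩ := exists_isMaxAt F
  have hA : ∀ p, ∃ a, (∃ a, IsMaxAt F p a) → IsMaxAt F p a := by
    intro p
    by_cases h : ∃ a, IsMaxAt F p a
    · exact h.imp fun a ha _ => ha
    · exact ⟨0, fun h' => absurd h' h⟩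
  choose A hA using hA
  set E : Set (Exp n) := {p | ∃ a, IsMaxAt F p a} with hE
  have hfin : E.Finite := (finite_deg (∑ j, (F j).deg + (n + 1))).subset
    fun p ⟨a, ha⟩ => ha.deg_le
  set H : Exp n → ℝ := fun p => Phi F Finset.univ (A p) - dot (toR p) (A p) with hH
  obtain ⟨p, hpE, hpmin⟩ := Set.exists_min_image E (fun p => y p + H p) hfin ⟨p0, a0, h0⟩
  have hpA := hA p hpE
  set a := A p with ha
  obtain ⟨j, hj⟩ := hF a
  obtain ⟨I0, hI0, hI0a, huniq⟩ := exists_unique_of_not_root (F j) a hj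
  set s := Finset.univ.erase j with hs
  set x := toR p - toR I0 with hx
  set G : (Fin n → ℝ) → ℝ := fun b => Phi F s b - dot x b with hG
  have hsplit : ∀ b, Phi F Finset.univ b = Phi F s b + (F j).eval b := by
    intro b
    unfold Phi
    rw [← Finset.sum_erase_add _ _ (Finset.mem_univ j)]
    ring
  have hGs : StrictConcaveOn ℝ Set.univ G := strictConcave_Phi_sub F s x
  have hGc : Continuous G := (continuous_Phi F s).sub (continuous_dot _)
  have hGa : ∀ b, G b ≤ G a := by
    have hloc : IsLocalMax G a := by
      filter_upwards [eventually_eval (F j) a hI0 hI0a huniq] with b hb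
      have h1 := hpA b
      rw [hsplit, hsplit, hb, hI0a, mono_eq, mono_eq] at h1
      simp only [hG, hx, dot_sub_left]
      linarith
    exact IsMaxOn.of_isLocalMax_of_convex_univ hloc hGs.concaveOn
  have hGlt : ∀ b, b ≠ a → G b < G a := by
    intro b hb
    refine lt_of_le_of_ne (hGa b) fun he => hb ?_
    exact hGs.eq_of_isMaxOn (fun x _ => by simpa [he] using hGa x) (fun x _ => hGa x)
      (Set.mem_univ _) (Set.mem_univ _)
  obtain ⟨hx0, hx1⟩ := slope_bounds (Phi_mono F s) (Phi_sub F s) x a hGa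
  have hle : I0 ≤ p := by
    intro l
    have := hx0 l
    simp only [hx, toR, Pi.sub_apply, sub_nonneg] at this
    exact_mod_cast this
  obtain ⟨J, rfl⟩ : ∃ J, p = J + I0 := ⟨p - I0, (tsub_add_cancel_of_le hle).symm⟩
  have hxJ : x = toR J := by rw [hx, toR_add, add_sub_cancel_right]
  have hJ : expDeg J + (F j).deg ≤ N := by
    rw [hxJ, dot_toR_one] at hx1
    have : expDeg J ≤ ∑ i ∈ s, (F i).deg + (n + 1) := by exact_mod_cast hx1
    have : ∑ i ∈ s, (F i).deg + (F j).deg = ∑ i, (F i).deg :=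
      Finset.sum_erase_add Finset.univ (fun i => (F i).deg) (Finset.mem_univ j)
    omega
  have hval : ∀ I ∈ (F j).supp, macVal (F j) J (fun I => (y I : WithTop ℝ)) (J + I) =
      (((F j).coeff I + y (J + I) : ℝ) : WithTop ℝ) := by
    intro I hI
    simp [macVal, shiftCoeff, hI]
  obtain ⟨q, hqp, hqmin⟩ : ∃ q, q ≠ J + I0 ∧ macVal (F j) J (fun I => (y I : WithTop ℝ)) q ≤
      macVal (F j) J (fun I => (y I : WithTop ℝ)) (J + I0) := by
    obtain ⟨I1, I2, hne, h1, h2, heq, hmin⟩ := hy j J hJ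
    have hd : expDeg (J + I0) ≤ N := hpA.deg_le.trans hN
    by_cases h : I1 = J + I0
    · exact ⟨I2, fun h' => hne (h.trans h'.symm), heq ▸ hmin _ hd⟩
    · exact ⟨I1, h, hmin _ hd⟩
  rw [hval I0 hI0] at hqmin
  have hq : J ≤ q ∧ q - J ∈ (F j).supp := by
    by_contra hcon
    rw [macVal, shiftCoeff, if_neg hcon] at hqmin
    simp at hqmin
  obtain ⟨I, rfl⟩ : ∃ I, q = J + I := ⟨q - J, (add_tsub_cancel_of_le hq.1).symm⟩
  have hI : I ∈ (F j).supp := by simpa using hq.2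
  have hII0 : I ≠ I0 := fun h => hqp (by rw [h])
  rw [hval I hI, WithTop.coe_le_coe] at hqmin
  have hsp : ∀ K b, Phi F Finset.univ b - dot (toR (J + K)) b =
      G b + ((F j).eval b - dot (toR K) b) := by
    intro K b
    simp only [hsplit, hG, hxJ, toR_add, dot_add_left]
    ring
  have hqE : J + I ∈ E := by
    obtain ⟨c, hc⟩ := exists_max_of_le hGs hGc
      (h := fun b => (F j).eval b - dot (toR I) b)
      ((continuous_eval (F j)).sub (continuous_dot _)) hGa (C := (F j).coeff I) (fun b => by
        have := eval_le (F j) hI b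
        rw [mono_eq] at this
        linarith)
    refine ⟨c, fun b => ?_⟩
    rw [hsp, hsp]
    exact hc b
  have hmin := hpmin _ hqE
  have hHp : H (J + I0) = G a + (F j).coeff I0 := by
    simp only [hH, ← ha, hsp, hI0a, mono_eq]
    ring
  have hHq : H (J + I) < G a + (F j).coeff I := by
    simp only [hH, hsp]
    by_cases hb : A (J + I) = a
    · rw [hb]
      have := huniq I hI hII0
      rw [mono_eq] at this
      linarith
    · have h1 := hGlt _ hb
      have := eval_le (F j) hI (A (J + I))
      rw [mono_eq] at this
      linarith
  linarith

lemma solution_of_root {k : ℕ} (F : Fin k → TropPoly n) (N : ℕ) (a : Fin n → ℝ)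
    (ha : ∀ j : Fin k, (F j).IsRoot a) : IsMacaulaySol F N (fun I => dot (toR I) a) := by
  intro j J hJ
  have hval : ∀ I ∈ (F j).supp,
      macVal (F j) J (fun I => ((dot (toR I) a : ℝ) : WithTop ℝ)) (J + I) =
      (((F j).mono I a + dot (toR J) a : ℝ) : WithTop ℝ) := by
    intro I hI
    simp only [macVal, shiftCoeff, le_add_iff_nonneg_right, zero_le, add_tsub_cancel_left, hI,
      and_self, if_true, mono_eq, toR_add, dot_add_left]
    rw [← WithTop.coe_add]
    congr 1
    ring
  have hdeg : ∀ I ∈ (F j).supp, expDeg (J + I) ≤ N := by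
    intro I hI
    have h1 : expDeg I ≤ (F j).deg := Finset.le_sup (f := expDeg) hI
    have h2 : expDeg (J + I) = expDeg J + expDeg I := by
      simp [expDeg, Finset.sum_add_distrib]
    omega
  obtain ⟨I1, h1, I2, h2, hne, e1, e2⟩ := ha j
  refine ⟨J + I1, J + I2, fun h => hne (add_left_cancel h), hdeg _ h1, hdeg _ h2, ?_, ?_⟩
  · rw [hval _ h1, hval _ h2, e1, e2]
  · intro q _
    by_cases hq : J ≤ q ∧ q - J ∈ (F j).supp
    · obtain ⟨I, rfl⟩ : ∃ I, q = J + I := ⟨q - J, (add_tsub_cancel_of_le hq.1).symm⟩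
      have hI : I ∈ (F j).supp := by simpa using hq.2
      rw [hval _ h1, hval _ hI, e1, WithTop.coe_le_coe]
      have := eval_le (F j) hI a
      linarith
    · rw [macVal, macVal, shiftCoeff, shiftCoeff, if_neg hq]
      simp

end TropAux

/-- **Tropical dual Nullstellensatz over ℝ** : a system `F = {f_1, …, f_k}` of tropical
polynomials in `n` variables over `ℝ` has a root iff the Macaulay tropical linear system
`M_N ⊙ y` with `N = (n+2)(d_1 + ⋯ + d_k)` has a solution. -/
theorem tropical_dual_nullstellensatz_real (n k : ℕ) (hk : 1 ≤ k)
    (F : Fin k → TropPoly n) :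
    (∃ a : Fin n → ℝ, ∀ j : Fin k, (F j).IsRoot a) ↔
      (∃ y : Exp n → ℝ, IsMacaulaySol F ((n + 2) * ∑ j, (F j).deg) y) := by
  constructor
  · rintro ⟨a, ha⟩
    exact ⟨_, TropAux.solution_of_root F _ a ha⟩
  · rintro ⟨y, hy⟩
    by_contra hF
    rcases Nat.eq_zero_or_pos (∑ j, (F j).deg) with h0 | hpos
    · have hd : (F ⟨0, hk⟩).deg = 0 := by
        rw [Finset.sum_eq_zero_iff] at h0
        exact h0 _ (Finset.mem_univ _)
      rw [h0, mul_zero] at hy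
      obtain ⟨I1, I2, hne, h1, h2, -⟩ := hy ⟨0, hk⟩ 0 (by simp [expDeg, hd])
      apply hne
      simp only [expDeg, nonpos_iff_eq_zero, Finset.sum_eq_zero_iff] at h1 h2
      ext l
      rw [h1 l (Finset.mem_univ l), h2 l (Finset.mem_univ l)]
    · refine TropAux.no_solution F ?_ hF y hy
      nlinarith
end

section
/- Let F = {f_1, …, f_k} (k ≥ 1) be a system of tropical polynomials in n variables over ℝ∞, each of degree at most d (d ≥ 1), and set N = 2(n+2)²·k·(4d)^{min(n,k)+2}. Then F has a root in ℝ∞^n if and only if the non-homogeneous Macaulay tropical linear system M_N ⊙ (0, y) of F has a solution. -/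
open scoped Classical

/-- `y` is a solution of the Macaulay tropical linear system of `F` over `ℝ∞`:
for every `j` and every `J` with `|J| + deg f_j ≤ N`, the minimum over all `I` with
`|I| ≤ N` of `c_{f_j}(I-J) + y_I` either equals `+∞` or is attained for at least two
distinct `I`. -/
noncomputable def IsMacaulaySolT {n k : ℕ} (F : Fin k → TropPoly n) (N : ℕ)
    (y : Exp n → WithTop ℝ) : Prop :=
  ∀ j : Fin k, ∀ J : Exp n, expDeg J + (F j).deg ≤ N →
    (∀ I : Exp n, expDeg I ≤ N → macVal (F j) J y I = ⊤) ∨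
    ∃ I₁ I₂ : Exp n, I₁ ≠ I₂ ∧ expDeg I₁ ≤ N ∧ expDeg I₂ ≤ N ∧
      macVal (F j) J y I₁ = macVal (F j) J y I₂ ∧
      ∀ I : Exp n, expDeg I ≤ N → macVal (F j) J y I₁ ≤ macVal (F j) J y I

/-! ### Auxiliary: families of terms and a strictly concave potential -/

/-- A single tropical term evaluated at a real point. -/
noncomputable def tval {n : ℕ} (t : Exp n × ℝ) (a : Fin n → ℝ) : ℝ :=
  t.2 + ∑ j, (t.1 j : ℝ) * a j

/-- Value of a finite family of terms (junk `0` when empty). -/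
noncomputable def teval {n : ℕ} (T : Finset (Exp n × ℝ)) (a : Fin n → ℝ) : ℝ :=
  if h : T.Nonempty then T.inf' h (fun t => tval t a) else 0

/-- Root condition for a family of terms. -/
def TRoot {n : ℕ} (T : Finset (Exp n × ℝ)) (a : Fin n → ℝ) : Prop :=
  ∀ t ∈ T, ∃ t' ∈ T, t'.1 ≠ t.1 ∧ tval t' a ≤ tval t a

lemma teval_le {n : ℕ} {T : Finset (Exp n × ℝ)} {t : Exp n × ℝ} (ht : t ∈ T) (a : Fin n → ℝ) :
    teval T a ≤ tval t a := by
  unfold teval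
  rw [dif_pos ⟨t, ht⟩]
  exact Finset.inf'_le _ ht

lemma exists_teval {n : ℕ} {T : Finset (Exp n × ℝ)} (hT : T.Nonempty) (a : Fin n → ℝ) :
    ∃ t ∈ T, teval T a = tval t a := by
  unfold teval
  rw [dif_pos hT]
  exact Finset.exists_mem_eq_inf' hT _

lemma continuous_tval {n : ℕ} (t : Exp n × ℝ) : Continuous (tval t) := by
  unfold tval
  fun_prop

lemma continuous_teval {n : ℕ} {T : Finset (Exp n × ℝ)} (hT : T.Nonempty) :
    Continuous (teval T) := by
  have : teval T = fun a => T.inf' hT (fun t => tval t a) := by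
    funext a; unfold teval; rw [dif_pos hT]
  rw [this]
  exact Continuous.finset_inf'_apply hT (fun t _ => continuous_tval t)

lemma tval_combo {n : ℕ} (t : Exp n × ℝ) (x y : Fin n → ℝ) (a b : ℝ) (hab : a + b = 1) :
    tval t (a • x + b • y) = a * tval t x + b * tval t y := by
  unfold tval
  have : ∑ j, (t.1 j : ℝ) * (a • x + b • y) j
      = a * ∑ j, (t.1 j : ℝ) * x j + b * ∑ j, (t.1 j : ℝ) * y j := by
    rw [Finset.mul_sum, Finset.mul_sum, ← Finset.sum_add_distrib]
    refine Finset.sum_congr rfl fun j _ => ?_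
    simp only [Pi.add_apply, Pi.smul_apply, smul_eq_mul]
    ring
  rw [this]
  have hb : b = 1 - a := by linarith
  subst hb
  ring

lemma concave_teval {n : ℕ} {T : Finset (Exp n × ℝ)} (hT : T.Nonempty) :
    ConcaveOn ℝ Set.univ (teval T) := by
  refine ⟨convex_univ, ?_⟩
  intro x _ y _ a b ha hb hab
  obtain ⟨t, ht, he⟩ := exists_teval hT (a • x + b • y)
  rw [he, tval_combo t x y a b hab]
  simp only [smul_eq_mul]
  have h1 := mul_le_mul_of_nonneg_left (teval_le ht x) ha
  have h2 := mul_le_mul_of_nonneg_left (teval_le ht y) hb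
  linarith

lemma sqrt_strict {x y a b : ℝ} (hxy : x ≠ y) (ha : 0 < a) (hb : 0 < b) (hab : a + b = 1) :
    √(1 + (a * x + b * y) ^ 2) < a * √(1 + x ^ 2) + b * √(1 + y ^ 2) := by
  have hx : 0 < √(1 + x ^ 2) := Real.sqrt_pos.2 (by positivity)
  have hy : 0 < √(1 + y ^ 2) := Real.sqrt_pos.2 (by positivity)
  have hx2 : √(1 + x ^ 2) ^ 2 = 1 + x ^ 2 := Real.sq_sqrt (by positivity)
  have hy2 : √(1 + y ^ 2) ^ 2 = 1 + y ^ 2 := Real.sq_sqrt (by positivity)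
  have hprod : 1 + x * y < √(1 + x ^ 2) * √(1 + y ^ 2) := by
    rw [← Real.sqrt_mul (by positivity)]
    apply Real.lt_sqrt_of_sq_lt
    have : 0 < (x - y) ^ 2 := by
      have := sub_ne_zero.2 hxy
      positivity
    nlinarith
  rw [Real.sqrt_lt' (by positivity)]
  have hbe : b = 1 - a := by linarith
  have e1 : (a * √(1 + x ^ 2) + b * √(1 + y ^ 2)) ^ 2
      = a ^ 2 * (1 + x ^ 2) + b ^ 2 * (1 + y ^ 2)
        + 2 * (a * b) * (√(1 + x ^ 2) * √(1 + y ^ 2)) := by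
    rw [← hx2, ← hy2]
    rw [hx2, hy2]
    ring_nf
    rw [hx2, hy2]
    ring
  rw [e1]
  have h2 : 2 * (a * b) * (1 + x * y) < 2 * (a * b) * (√(1 + x ^ 2) * √(1 + y ^ 2)) :=
    mul_lt_mul_of_pos_left hprod (by positivity)
  have h3 : 1 = a ^ 2 + b ^ 2 + 2 * (a * b) := by rw [hbe]; ring
  nlinarith

/-- The strictly concave potential. -/
noncomputable def phi {n : ℕ} (a : Fin n → ℝ) : ℝ := ∑ j, (-(1 / 2) * √(1 + a j ^ 2))

lemma continuous_phi {n : ℕ} : Continuous (phi (n := n)) := by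
  unfold phi
  fun_prop

lemma strictConcave_phi {n : ℕ} : StrictConcaveOn ℝ Set.univ (phi (n := n)) := by
  refine ⟨convex_univ, ?_⟩
  intro x _ y _ hxy a b ha hb hab
  unfold phi
  simp only [smul_eq_mul, Finset.mul_sum]
  rw [← Finset.sum_add_distrib]
  obtain ⟨j, hj⟩ := Function.ne_iff.1 hxy
  apply Finset.sum_lt_sum
  · intro i _
    simp only [Pi.add_apply, Pi.smul_apply, smul_eq_mul]
    by_cases h : x i = y i
    · rw [h, ← add_mul a b, hab, ← add_mul a b, hab, one_mul, one_mul]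
    · have := sqrt_strict h ha hb hab
      linarith
  · refine ⟨j, Finset.mem_univ _, ?_⟩
    simp only [Pi.add_apply, Pi.smul_apply, smul_eq_mul]
    have := sqrt_strict hj ha hb hab
    linarith

lemma sqrt_step (t u : ℝ) (hu : |u| ≤ 1) : √(1 + (t + u) ^ 2) ≤ √(1 + t ^ 2) + 1 := by
  have h0 : |t| ≤ √(1 + t ^ 2) := Real.abs_le_sqrt (by linarith)
  have h1 : √(1 + t ^ 2) ^ 2 = 1 + t ^ 2 := Real.sq_sqrt (by positivity)
  rw [Real.sqrt_le_left (by positivity)]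
  have h2 : t * u ≤ |t| := by
    calc t * u ≤ |t * u| := le_abs_self _
      _ = |t| * |u| := abs_mul _ _
      _ ≤ |t| * 1 := mul_le_mul_of_nonneg_left hu (abs_nonneg _)
      _ = |t| := mul_one _
  have h3 : u ^ 2 ≤ 1 := by rw [← sq_abs]; nlinarith [abs_nonneg u]
  nlinarith

lemma coercive_of_unique {n : ℕ} (P : (Fin n → ℝ) → ℝ) (hc : Continuous P)
    (hP : ConcaveOn ℝ Set.univ P) (a : Fin n → ℝ) (ha : ∀ b, b ≠ a → P b < P a) :
    ∃ C ε : ℝ, 0 < ε ∧ ∀ b, P b ≤ C - ε * ‖b‖ := by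
  have key : ∃ ε : ℝ, 0 < ε ∧ ∀ c ∈ Metric.sphere a 1, P c ≤ P a - ε := by
    by_cases hne : (Metric.sphere a (1 : ℝ)).Nonempty
    · obtain ⟨c0, hc0, hm⟩ := (isCompact_sphere a 1).exists_isMaxOn hne hc.continuousOn
      refine ⟨P a - P c0, ?_, ?_⟩
      · have : c0 ≠ a := by
          rintro rfl
          simp at hc0
        linarith [ha c0 this]
      · intro c hcs
        have := hm hcs
        simp only [Set.mem_ofPred_eq] at this
        linarith
    · exact ⟨1, one_pos, fun c hcs => (hne ⟨c, hcs⟩).elim⟩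
  obtain ⟨ε, hε, hs⟩ := key
  refine ⟨P a + ε + ε * ‖a‖, ε, hε, fun b => ?_⟩
  have hb : ‖b‖ ≤ ‖b - a‖ + ‖a‖ := by
    calc ‖b‖ = ‖(b - a) + a‖ := by simp
      _ ≤ _ := norm_add_le _ _
  have main : P b ≤ P a + ε - ε * ‖b - a‖ := by
    rcases le_or_gt ‖b - a‖ 1 with h | h
    · have h1 : P b ≤ P a := by
        by_cases e : b = a
        · rw [e]
        · exact (ha b e).le
      nlinarith
    · set r := ‖b - a‖ with hr
      have hr0 : 0 < r := by linarith
      have hmem : (1 - r⁻¹) • a + r⁻¹ • b ∈ Metric.sphere a (1 : ℝ) := by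
        rw [mem_sphere_iff_norm]
        have : (1 - r⁻¹) • a + r⁻¹ • b - a = r⁻¹ • (b - a) := by
          module
        rw [this, norm_smul, ← hr, Real.norm_of_nonneg (by positivity)]
        field_simp
      have hri : r⁻¹ ≤ 1 := inv_le_one_of_one_le₀ h.le
      have h2 := hP.2 (Set.mem_univ a) (Set.mem_univ b) (sub_nonneg.2 hri)
        (inv_nonneg.2 hr0.le) (by ring)
      have h3 := hs _ hmem
      simp only [smul_eq_mul] at h2
      have h4 : r⁻¹ * P b ≤ r⁻¹ * P a - ε := by linarith
      have h5 := mul_le_mul_of_nonneg_left h4 hr0.le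
      have e1 : r * (r⁻¹ * P b) = P b := by field_simp
      have e2 : r * (r⁻¹ * P a - ε) = P a - ε * r := by field_simp
      rw [e1, e2] at h5
      linarith
  nlinarith

lemma exists_max_of_coercive {n : ℕ} (P : (Fin n → ℝ) → ℝ) (hc : Continuous P)
    (h : ∃ C ε : ℝ, 0 < ε ∧ ∀ b, P b ≤ C - ε * ‖b‖) : ∃ a, ∀ b, P b ≤ P a := by
  obtain ⟨C, ε, hε, hb⟩ := h
  apply hc.exists_forall_ge
  apply Filter.tendsto_atBot_mono hb
  have h1 : Filter.Tendsto (fun b : Fin n → ℝ => ε * ‖b‖) (Filter.cocompact _) Filter.atTop :=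
    (tendsto_norm_cocompact_atTop).const_mul_atTop hε
  have h2 := Filter.tendsto_atBot_add_const_left (Filter.cocompact (Fin n → ℝ)) C
    (Filter.tendsto_neg_atTop_atBot.comp h1)
  exact h2

/-- The potential attached to a family and a lattice point. -/
noncomputable def HH {n : ℕ} {ι : Type} [Fintype ι] (g : ι → Finset (Exp n × ℝ)) (q : Exp n)
    (a : Fin n → ℝ) : ℝ :=
  phi a + ∑ l, teval (g l) a - ∑ j, (q j : ℝ) * a j

/-- Coercivity of the potential. -/
def Coer {n : ℕ} {ι : Type} [Fintype ι] (g : ι → Finset (Exp n × ℝ)) (q : Exp n) : Prop :=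
  ∃ C ε : ℝ, 0 < ε ∧ ∀ b, HH g q b ≤ C - ε * ‖b‖

lemma continuous_HH {n : ℕ} {ι : Type} [Fintype ι] (g : ι → Finset (Exp n × ℝ))
    (hg : ∀ l, (g l).Nonempty) (q : Exp n) : Continuous (HH g q) := by
  unfold HH
  have h1 : Continuous fun a : Fin n → ℝ => ∑ l, teval (g l) a :=
    continuous_finsetSum _ fun l _ => continuous_teval (hg l)
  have h2 := continuous_phi (n := n)
  have h3 : Continuous fun a : Fin n → ℝ => ∑ j, (q j : ℝ) * a j := by fun_prop
  exact (h2.add h1).sub h3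

lemma coer_zero {n : ℕ} {ι : Type} [Fintype ι] (g : ι → Finset (Exp n × ℝ))
    (h0 : ∀ l, ∃ t ∈ g l, t.1 = 0) : Coer g 0 := by
  choose t ht ht0 using h0
  refine ⟨∑ l, (t l).2, 1 / 2, by norm_num, fun b => ?_⟩
  unfold HH
  have h1 : ∑ l, teval (g l) b ≤ ∑ l, (t l).2 := by
    apply Finset.sum_le_sum
    intro l _
    have := teval_le (ht l) b
    unfold tval at this
    rw [ht0 l] at this
    simpa using this
  have h2 : phi b ≤ -(1 / 2) * ‖b‖ := by
    have h3 : ‖b‖ ≤ -2 * phi b := by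
      have e : -2 * phi b = ∑ j, √(1 + b j ^ 2) := by
        unfold phi
        rw [Finset.mul_sum]
        refine Finset.sum_congr rfl fun j _ => ?_
        ring
      rw [e]
      rw [pi_norm_le_iff_of_nonneg (Finset.sum_nonneg fun j _ => Real.sqrt_nonneg _)]
      intro j
      have h4 : ‖b j‖ ≤ √(1 + b j ^ 2) := by
        rw [Real.norm_eq_abs]
        exact Real.abs_le_sqrt (by linarith)
      exact h4.trans (Finset.single_le_sum (f := fun j => √(1 + b j ^ 2))
        (fun j _ => Real.sqrt_nonneg _) (Finset.mem_univ j))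
    linarith
  simp only [Pi.zero_apply, Nat.cast_zero, zero_mul, Finset.sum_const_zero, sub_zero]
  linarith

lemma exists_unique_min {n : ℕ} {T : Finset (Exp n × ℝ)} {a : Fin n → ℝ} (h : ¬ TRoot T a) :
    ∃ t ∈ T, (∀ t' ∈ T, tval t a ≤ tval t' a) ∧ ∀ t' ∈ T, t'.1 ≠ t.1 → tval t a < tval t' a := by
  unfold TRoot at h
  push Not at h
  obtain ⟨s, hs, hlt⟩ := h
  obtain ⟨t, ht, hmin⟩ := T.exists_min_image (fun t => tval t a) ⟨s, hs⟩
  refine ⟨t, ht, hmin, ?_⟩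
  have hts : t.1 = s.1 := by
    by_contra hne
    exact absurd (hmin s hs) (not_le.2 (hlt t ht hne))
  intro t' ht' hne
  rw [hts] at hne
  exact lt_of_le_of_lt (hmin s hs) (hlt t' ht' hne)

lemma sum_cast_mul_mono {n : ℕ} {T : Finset (Exp n × ℝ)} (hT : T.Nonempty) (D : ℕ)
    (hD : ∀ t ∈ T, expDeg t.1 ≤ D) (a : Fin n → ℝ) :
    teval T a - D ≤ teval T (fun j => a j - 1) := by
  obtain ⟨t, ht, he⟩ := exists_teval hT (fun j => a j - 1)
  rw [he]
  have h1 := teval_le ht a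
  have h2 : tval t (fun j => a j - 1) = tval t a - (expDeg t.1 : ℕ) := by
    unfold tval expDeg
    push_cast
    simp only [mul_sub, mul_one, Finset.sum_sub_distrib]
    ring
  have h3 : ((expDeg t.1 : ℕ) : ℝ) ≤ D := by exact_mod_cast hD t ht
  linarith

lemma teval_mono {n : ℕ} {T : Finset (Exp n × ℝ)} (hT : T.Nonempty) {a b : Fin n → ℝ}
    (hab : ∀ j, a j ≤ b j) : teval T a ≤ teval T b := by
  obtain ⟨t, ht, he⟩ := exists_teval hT b
  rw [he]
  refine (teval_le ht a).trans ?_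
  unfold tval
  have : ∑ j, (t.1 j : ℝ) * a j ≤ ∑ j, (t.1 j : ℝ) * b j :=
    Finset.sum_le_sum fun j _ => mul_le_mul_of_nonneg_left (hab j) (Nat.cast_nonneg _)
  linarith

lemma phi_shift {n : ℕ} (a u : Fin n → ℝ) (hu : ∀ j, |u j| ≤ 1) :
    phi a - n / 2 ≤ phi (a + u) := by
  have : (n : ℝ) / 2 = ∑ _j : Fin n, (1 / 2 : ℝ) := by
    simp; ring
  rw [this]
  unfold phi
  rw [← Finset.sum_sub_distrib]
  apply Finset.sum_le_sum
  intro j _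
  have := sqrt_step (a j) (u j) (hu j)
  simp only [Pi.add_apply]
  linarith

lemma phi_single {n : ℕ} (a b : Fin n → ℝ) (j : Fin n) (hj : b j = a j + 1)
    (hb : ∀ i, i ≠ j → b i = a i) : phi a - 1 / 2 ≤ phi b := by
  unfold phi
  rw [← Finset.add_sum_erase _ _ (Finset.mem_univ j),
    ← Finset.add_sum_erase _ (fun i => -(1 / 2) * √(1 + b i ^ 2)) (Finset.mem_univ j)]
  have h1 : ∑ i ∈ Finset.univ.erase j, -(1 / 2) * √(1 + b i ^ 2)
      = ∑ i ∈ Finset.univ.erase j, -(1 / 2) * √(1 + a i ^ 2) := by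
    refine Finset.sum_congr rfl fun i hi => ?_
    rw [hb i (Finset.mem_erase.1 hi).1]
  rw [h1, hj]
  have := sqrt_step (a j) 1 (by simp)
  linarith

lemma eventually_teval {n : ℕ} {T : Finset (Exp n × ℝ)} {a : Fin n → ℝ} {t : Exp n × ℝ}
    (ht : t ∈ T) (hmin : ∀ t' ∈ T, tval t a ≤ tval t' a)
    (hlt : ∀ t' ∈ T, t'.1 ≠ t.1 → tval t a < tval t' a) :
    ∀ᶠ b in nhds a, teval T b = tval t b := by
  have h : ∀ t' ∈ T, ∀ᶠ b in nhds a, tval t b ≤ tval t' b := by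
    intro t' ht'
    by_cases e : t'.1 = t.1
    · refine Filter.Eventually.of_forall fun b => ?_
      have := hmin t' ht'
      unfold tval at this ⊢
      rw [e] at this ⊢
      linarith
    · have := (continuous_tval t).continuousAt.eventually_lt
        (continuous_tval t').continuousAt (hlt t' ht' e)
      exact this.mono fun b hb => hb.le
  have h2 := (Filter.eventually_all_finset T).2 h
  refine h2.mono fun b hb => ?_
  apply le_antisymm (teval_le ht b)
  obtain ⟨t', ht', he⟩ := exists_teval ⟨t, ht⟩ b
  rw [he]
  exact hb t' ht'

lemma key_step {n : ℕ} {ι : Type} [Fintype ι] (g : ι → Finset (Exp n × ℝ))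
    (hg : ∀ l, (g l).Nonempty) (D : ℕ) (hD : ∀ l, ∀ t ∈ g l, expDeg t.1 ≤ D)
    (hroot : ∀ a, ∃ l, ¬ TRoot (g l) a) (q : Exp n) (a : Fin n → ℝ)
    (ha : ∀ b, HH g q b ≤ HH g q a) :
    ∃ l, ∃ t ∈ g l, t.1 ≤ q ∧ expDeg (q - t.1) ≤ Fintype.card ι * D + n ∧
      ∀ t' ∈ g l, t'.1 ≠ t.1 → Coer g (q - t.1 + t'.1) ∧
        ∀ b, HH g (q - t.1 + t'.1) b < t'.2 - t.2 + HH g q a := by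
  obtain ⟨l, hl⟩ := hroot a
  obtain ⟨t, ht, hmin, hlt⟩ := exists_unique_min hl
  refine ⟨l, t, ht, ?_⟩
  set P : (Fin n → ℝ) → ℝ := fun b =>
    phi b + (∑ l' ∈ Finset.univ.erase l, teval (g l') b - ∑ j, ((q j : ℝ) - t.1 j) * b j) with hP
  have hHP : ∀ b, HH g q b = P b + (teval (g l) b - ∑ j, (t.1 j : ℝ) * b j) := by
    intro b
    simp only [hP, HH]
    rw [← Finset.add_sum_erase _ _ (Finset.mem_univ l)]
    simp only [sub_mul, Finset.sum_sub_distrib]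
    ring
  have hPc : Continuous P := by
    have h1 : Continuous fun b : Fin n → ℝ => ∑ l' ∈ Finset.univ.erase l, teval (g l') b :=
      continuous_finsetSum _ fun l _ => continuous_teval (hg l)
    have h3 : Continuous fun b : Fin n → ℝ => ∑ j, ((q j : ℝ) - t.1 j) * b j := by fun_prop
    exact continuous_phi.add (h1.sub h3)
  have hPs : StrictConcaveOn ℝ Set.univ P := by
    apply strictConcave_phi.add_concaveOn
    refine ⟨convex_univ, ?_⟩
    intro x _ y _ α β hα hβ hab
    simp only [smul_eq_mul, mul_sub, Finset.mul_sum]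
    have h1 : ∑ l' ∈ Finset.univ.erase l, α * teval (g l') x
        + ∑ l' ∈ Finset.univ.erase l, β * teval (g l') y
        ≤ ∑ l' ∈ Finset.univ.erase l, teval (g l') (α • x + β • y) := by
      rw [← Finset.sum_add_distrib]
      refine Finset.sum_le_sum fun l' _ => ?_
      have := (concave_teval (hg l')).2 (Set.mem_univ x) (Set.mem_univ y) hα hβ hab
      simpa only [smul_eq_mul] using this
    have h2 : ∑ j, ((q j : ℝ) - t.1 j) * (α • x + β • y) j
        = ∑ j, α * (((q j : ℝ) - t.1 j) * x j) + ∑ j, β * (((q j : ℝ) - t.1 j) * y j) := by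
      rw [← Finset.sum_add_distrib]
      refine Finset.sum_congr rfl fun j _ => ?_
      simp only [Pi.add_apply, Pi.smul_apply, smul_eq_mul]
      ring
    linarith
  have hev := eventually_teval ht hmin hlt
  have hta : teval (g l) a = tval t a := hev.self_of_nhds
  have hloc : IsLocalMax P a := by
    refine hev.mono fun b hb => ?_
    have h1 := ha b
    rw [hHP, hHP, hb, hta] at h1
    unfold tval at h1
    linarith
  have hPmax : ∀ b, P b ≤ P a := IsMaxOn.of_isLocalMax_of_convex_univ hloc hPs.concaveOn
  have hPlt : ∀ b, b ≠ a → P b < P a := by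
    intro b hb
    refine lt_of_le_of_ne (hPmax b) fun he => hb ?_
    refine hPs.eq_of_isMaxOn (fun c _ => ?_) (fun c _ => ?_) (Set.mem_univ b) (Set.mem_univ a)
    · show P c ≤ P b
      rw [he]; exact hPmax c
    · exact hPmax c
  have hPa : HH g q a = P a + t.2 := by
    rw [hHP, hta]; unfold tval; ring
  have hle : t.1 ≤ q := by
    intro j
    have h1 := hPmax (a + Pi.single j 1)
    simp only [hP] at h1
    have h2 := phi_single a (a + Pi.single j 1) j (by simp)
      (fun i hi => by simp [Pi.single_eq_of_ne hi])
    have h3 : ∑ l' ∈ Finset.univ.erase l, teval (g l') a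
        ≤ ∑ l' ∈ Finset.univ.erase l, teval (g l') (a + Pi.single j 1) := by
      refine Finset.sum_le_sum fun l' _ => teval_mono (hg l') fun i => ?_
      by_cases e : i = j
      · subst e; simp
      · simp [Pi.single_eq_of_ne e]
    have h4 : ∑ i, ((q i : ℝ) - t.1 i) * (a + Pi.single j 1 : Fin n → ℝ) i
        = ∑ i, ((q i : ℝ) - t.1 i) * a i + ((q j : ℝ) - t.1 j) := by
      simp only [Pi.add_apply, mul_add, Finset.sum_add_distrib]
      congr 1
      rw [Finset.sum_eq_single j]
      · simp
      · intro i _ hi; simp [Pi.single_eq_of_ne hi]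
      · simp
    rw [h4] at h1
    have h5 : (t.1 j : ℝ) ≤ q j + 1 / 2 := by linarith
    by_contra hcon
    push Not at hcon
    have h6 : (q j : ℝ) + 1 ≤ t.1 j := by exact_mod_cast hcon
    linarith
  have hdeg : expDeg (q - t.1) ≤ Fintype.card ι * D + n := by
    have h1 := hPmax (fun j => a j - 1)
    simp only [hP] at h1
    have h2 := phi_shift a (fun _ => -1) (by simp)
    have e : a + (fun _ => (-1 : ℝ)) = fun j => a j - 1 := by
      funext j; simp [sub_eq_add_neg]
    rw [e] at h2
    have h3 : ∑ l' ∈ Finset.univ.erase l, (teval (g l') a - D)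
        ≤ ∑ l' ∈ Finset.univ.erase l, teval (g l') (fun j => a j - 1) :=
      Finset.sum_le_sum fun l' _ => sum_cast_mul_mono (hg l') D (hD l') a
    rw [Finset.sum_sub_distrib, Finset.sum_const, nsmul_eq_mul] at h3
    have h4 : ((Finset.univ.erase l).card : ℝ) * D ≤ (Fintype.card ι : ℝ) * D := by
      apply mul_le_mul_of_nonneg_right _ (Nat.cast_nonneg _)
      exact_mod_cast Finset.card_le_univ _
    have h5 : ((expDeg (q - t.1) : ℕ) : ℝ) = ∑ j, ((q j : ℝ) - t.1 j) := by
      unfold expDeg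
      push_cast
      refine Finset.sum_congr rfl fun j _ => ?_
      rw [Pi.sub_apply, Nat.cast_sub (hle j)]
    simp only [mul_sub, mul_one] at h1
    rw [Finset.sum_sub_distrib, ← h5] at h1
    have h6 : ((expDeg (q - t.1) : ℕ) : ℝ) ≤ ((Fintype.card ι * D + n : ℕ) : ℝ) := by
      push_cast
      have : (0 : ℝ) ≤ n := Nat.cast_nonneg _
      linarith
    exact_mod_cast h6
  refine ⟨hle, hdeg, ?_⟩
  intro t' ht' hne
  have hH' : ∀ b, HH g (q - t.1 + t'.1) b
      = P b + (teval (g l) b - ∑ j, (t'.1 j : ℝ) * b j) := by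
    intro b
    simp only [hP, HH]
    rw [← Finset.add_sum_erase _ _ (Finset.mem_univ l)]
    have : ∑ j, (((q - t.1 + t'.1) j : ℕ) : ℝ) * b j
        = ∑ j, ((q j : ℝ) - t.1 j) * b j + ∑ j, (t'.1 j : ℝ) * b j := by
      rw [← Finset.sum_add_distrib]
      refine Finset.sum_congr rfl fun j _ => ?_
      simp only [Pi.add_apply, Pi.sub_apply]
      rw [Nat.cast_add, Nat.cast_sub (hle j)]
      ring
    rw [this]
    ring
  have hH'le : ∀ b, HH g (q - t.1 + t'.1) b ≤ P b + t'.2 := by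
    intro b
    rw [hH']
    have := teval_le ht' b
    unfold tval at this
    linarith
  constructor
  · obtain ⟨C, ε, hε, hb⟩ := coercive_of_unique P hPc hPs.concaveOn a hPlt
    refine ⟨C + t'.2, ε, hε, fun b => ?_⟩
    have h1 := hb b
    have h2 := hH'le b
    linarith
  · intro b
    by_cases e : b = a
    · rw [e, hH', hta, hPa]
      have := hlt t' ht' hne
      have h2 : tval t' a = t'.2 + ∑ j, (t'.1 j : ℝ) * a j := rfl
      linarith
    · have h1 := hPlt b e
      have h2 := hH'le b
      rw [hPa]
      linarith

lemma expDeg_le_finite (n M : ℕ) : {q : Exp n | expDeg q ≤ M}.Finite := by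
  refine (Set.finite_Iic (fun _ : Fin n => M)).subset ?_
  intro q hq j
  exact (Finset.single_le_sum (f := q) (fun _ _ => Nat.zero_le _) (Finset.mem_univ j)).trans hq

lemma expDeg_add {n : ℕ} (p q : Exp n) : expDeg (p + q) = expDeg p + expDeg q := by
  unfold expDeg
  simp [Finset.sum_add_distrib]

/-- The toric case: all polynomials have a constant term and there is no real root. -/
lemma toric_case {n : ℕ} {ι : Type} [Fintype ι] (g : ι → Finset (Exp n × ℝ))
    (h0 : ∀ l, ∃ t ∈ g l, t.1 = 0) (D : ℕ) (hD : ∀ l, ∀ t ∈ g l, expDeg t.1 ≤ D)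
    (hroot : ∀ a, ∃ l, ¬ TRoot (g l) a) (V : Set (Exp n)) (r : Exp n → ℝ)
    (hV : ∀ l, ∀ J : Exp n, expDeg J ≤ Fintype.card ι * D + n → ∀ t ∈ g l, J + t.1 ∈ V →
      ∃ t' ∈ g l, t'.1 ≠ t.1 ∧ J + t'.1 ∈ V ∧ t'.2 + r (J + t'.1) ≤ t.2 + r (J + t.1)) :
    0 ∉ V := by
  intro h0V
  have hg : ∀ l, (g l).Nonempty := fun l => by
    obtain ⟨t, ht, _⟩ := h0 l
    exact ⟨t, ht⟩
  have hmax : ∀ q, Coer g q → ∃ a, ∀ b, HH g q b ≤ HH g q a := fun q hq =>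
    exists_max_of_coercive _ (continuous_HH g hg q) hq
  choose! A hA using hmax
  set E : Set (Exp n) := {q | Coer g q ∧ q ∈ V} with hE
  have hfin : E.Finite := by
    refine (expDeg_le_finite n (Fintype.card ι * D + n + D)).subset ?_
    rintro q ⟨hq, _⟩
    obtain ⟨l, t, ht, hle, hdeg, _⟩ := key_step g hg D hD hroot q (A q) (hA q hq)
    have : q = (q - t.1) + t.1 := (tsub_add_cancel_of_le hle).symm
    show expDeg q ≤ _
    rw [this, expDeg_add]
    exact add_le_add hdeg (hD l t ht)
  obtain ⟨p, hp, hpm⟩ := Set.exists_min_image E (fun q => r q + HH g q (A q)) hfin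
    ⟨0, coer_zero g h0, h0V⟩
  obtain ⟨l, t, ht, hle, hdeg, hst⟩ := key_step g hg D hD hroot p (A p) (hA p hp.1)
  have hpe : (p - t.1) + t.1 = p := tsub_add_cancel_of_le hle
  obtain ⟨t', ht', hne, hmem, hval⟩ := hV l (p - t.1) hdeg t ht (by rw [hpe]; exact hp.2)
  obtain ⟨hco, hlt⟩ := hst t' ht' hne
  have h1 := hpm _ ⟨hco, hmem⟩
  have h2 := hlt (A (p - t.1 + t'.1))
  rw [hpe] at hval
  linarith

/-! ### From a real point to a point with infinite coordinates -/

lemma expDeg_le_of_mem {n : ℕ} {f : TropPoly n} {I : Exp n} (hI : I ∈ f.supp) :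
    expDeg I ≤ f.deg := Finset.le_sup (f := expDeg) hI

lemma inner_le {n d : ℕ} {I : Exp n} (hI : expDeg I ≤ d) {a : Fin n → ℝ} {B : ℝ} (hB : 0 ≤ B)
    (h : ∀ j, I j ≠ 0 → a j ≤ B) : ∑ j, (I j : ℝ) * a j ≤ d * B := by
  have h1 : ∑ j, (I j : ℝ) * a j ≤ ∑ j, (I j : ℝ) * B := by
    refine Finset.sum_le_sum fun j _ => ?_
    by_cases e : I j = 0
    · simp [e]
    · exact mul_le_mul_of_nonneg_left (h j e) (Nat.cast_nonneg _)
  rw [← Finset.sum_mul] at h1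
  have h2 : (∑ j, (I j : ℝ)) ≤ d := by
    unfold expDeg at hI
    exact_mod_cast hI
  exact h1.trans (mul_le_mul_of_nonneg_right h2 hB)

lemma le_inner {n d : ℕ} {I : Exp n} (hI : expDeg I ≤ d) {a : Fin n → ℝ} {s : ℝ} (hs : 0 ≤ s)
    (h : ∀ j, -s ≤ a j) : -(d * s) ≤ ∑ j, (I j : ℝ) * a j := by
  have h1 : ∑ j, (I j : ℝ) * (-s) ≤ ∑ j, (I j : ℝ) * a j :=
    Finset.sum_le_sum fun j _ => mul_le_mul_of_nonneg_left (h j) (Nat.cast_nonneg _)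
  rw [← Finset.sum_mul] at h1
  have h2 : (∑ j, (I j : ℝ)) ≤ d := by
    unfold expDeg at hI
    exact_mod_cast hI
  have h3 := mul_le_mul_of_nonneg_right h2 hs
  linarith

lemma lt_inner {n d : ℕ} {I : Exp n} (hI : expDeg I ≤ d) {a : Fin n → ℝ} {s B : ℝ} (hs : 0 ≤ s)
    (h : ∀ j, -s ≤ a j) {j : Fin n} (hj : I j ≠ 0) (hB : B < a j) :
    B - d * s < ∑ j, (I j : ℝ) * a j := by
  have h1 : (I j : ℝ) * (a j + s) ≤ ∑ j, (I j : ℝ) * (a j + s) :=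
    Finset.single_le_sum (f := fun j => (I j : ℝ) * (a j + s))
      (fun i _ => mul_nonneg (Nat.cast_nonneg _) (by linarith [h i])) (Finset.mem_univ j)
  have h0 : (1 : ℝ) ≤ I j := by exact_mod_cast Nat.one_le_iff_ne_zero.2 hj
  have h2 : 1 * (a j + s) ≤ (I j : ℝ) * (a j + s) :=
    mul_le_mul_of_nonneg_right h0 (by linarith [h j])
  simp only [mul_add, Finset.sum_add_distrib] at h1
  rw [← Finset.sum_mul] at h1
  have h3 : (∑ j, (I j : ℝ)) ≤ d := by
    unfold expDeg at hI
    exact_mod_cast hI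
  have h4 := mul_le_mul_of_nonneg_right h3 hs
  linarith

lemma exists_level {n : ℕ} (T : Finset (Exp n)) (hT : T.Nonempty) (a : Fin n → ℝ) (B₀ : ℝ) :
    ∃ β : ℝ, B₀ ≤ β ∧ (∃ I ∈ T, ∀ j, I j ≠ 0 → a j ≤ β) ∧
      (∀ I ∈ T, ∀ B, B₀ ≤ B → (∀ j, I j ≠ 0 → a j ≤ B) → β ≤ B) ∧
      (β = B₀ ∨ ∃ j, β = a j) := by
  have h : ∀ I : Exp n, ∃ μ : ℝ, B₀ ≤ μ ∧ (∀ j, I j ≠ 0 → a j ≤ μ) ∧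
      (∀ B, B₀ ≤ B → (∀ j, I j ≠ 0 → a j ≤ B) → μ ≤ B) ∧ (μ = B₀ ∨ ∃ j, μ = a j) := by
    intro I
    set S : Finset ℝ := insert B₀ ((Finset.univ.filter fun j => I j ≠ 0).image a) with hS
    have hne : S.Nonempty := ⟨B₀, Finset.mem_insert_self _ _⟩
    have hmem := S.max'_mem hne
    have hcases : S.max' hne = B₀ ∨ ∃ j, I j ≠ 0 ∧ a j = S.max' hne := by
      rcases Finset.mem_insert.1 hmem with h | h
      · exact Or.inl h
      · obtain ⟨j, hj, he⟩ := Finset.mem_image.1 h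
        exact Or.inr ⟨j, (Finset.mem_filter.1 hj).2, he⟩
    refine ⟨S.max' hne, S.le_max' _ (Finset.mem_insert_self _ _), ?_, ?_, ?_⟩
    · intro j hj
      exact S.le_max' _ (Finset.mem_insert_of_mem
        (Finset.mem_image_of_mem a (Finset.mem_filter.2 ⟨Finset.mem_univ j, hj⟩)))
    · intro B hB hall
      rcases hcases with h | ⟨j, hj, h⟩
      · rw [h]; exact hB
      · rw [← h]; exact hall j hj
    · rcases hcases with h | ⟨j, hj, h⟩
      · exact Or.inl h
      · exact Or.inr ⟨j, h.symm⟩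
  choose μ h1 h2 h3 h4 using h
  obtain ⟨I, hI, hmin⟩ := T.exists_min_image μ hT
  exact ⟨μ I, h1 I, ⟨I, hI, h2 I⟩, fun I' hI' B hB hall =>
    (hmin I' hI').trans (h3 I' B hB hall), h4 I⟩

lemma exists_gap {n k d : ℕ} (hd : 1 ≤ d) (a : Fin n → ℝ) (B₀ : ℝ) (hB₀ : 0 < B₀)
    (β : Fin k → ℝ) (hβa : ∀ i, β i = B₀ ∨ ∃ j, β i = a j) :
    ∃ l ≤ min n k, ∀ i, (3 * d : ℝ) ^ (l + 1) * B₀ < β i ∨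
      3 * d * β i ≤ (3 * d : ℝ) ^ (l + 1) * B₀ := by
  by_contra hcon
  push Not at hcon
  have hd1 : (1 : ℝ) ≤ d := by exact_mod_cast hd
  have h3 : (1 : ℝ) ≤ 3 * d := by linarith
  have hbad : ∀ l : Fin (min n k + 1), ∃ i, β i ≤ (3 * d : ℝ) ^ (l.1 + 1) * B₀ ∧
      (3 * d : ℝ) ^ l.1 * B₀ < β i := by
    intro l
    obtain ⟨i, hi1, hi2⟩ := hcon l.1 (Nat.lt_succ_iff.1 l.2)
    refine ⟨i, hi1, ?_⟩
    rw [pow_succ] at hi2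
    nlinarith
  choose u hu1 hu2 using hbad
  have key : ∀ l l' : Fin (min n k + 1), β (u l) = β (u l') → l ≤ l' := by
    intro l l' h
    by_contra hlt
    push Not at hlt
    have h1 := hu2 l
    have h2 := hu1 l'
    have h4 : (3 * d : ℝ) ^ (l'.1 + 1) * B₀ ≤ (3 * d : ℝ) ^ l.1 * B₀ :=
      mul_le_mul_of_nonneg_right (pow_le_pow_right₀ h3 hlt) hB₀.le
    linarith
  have hj : ∀ l, ∃ j, β (u l) = a j := by
    intro l
    rcases hβa (u l) with h | h
    · exfalso
      have h1 := hu2 l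
      have h2 : 1 * B₀ ≤ (3 * d : ℝ) ^ l.1 * B₀ :=
        mul_le_mul_of_nonneg_right (one_le_pow₀ h3) hB₀.le
      linarith
    · exact h
  choose v hv using hj
  have i1 : Function.Injective u := fun l l' h =>
    le_antisymm (key l l' (by rw [h])) (key l' l (by rw [h]))
  have i2 : Function.Injective v := fun l l' h =>
    le_antisymm (key l l' (by rw [hv, hv, h])) (key l' l (by rw [hv, hv, h]))
  have c1 := Fintype.card_le_of_injective u i1
  have c2 := Fintype.card_le_of_injective v i2
  simp only [Fintype.card_fin] at c1 c2
  omega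

lemma core {n k d : ℕ} (hd : 1 ≤ d) (F : Fin k → TropPoly n) (hdeg : ∀ j, (F j).deg ≤ d)
    (C : ℝ) (hC0 : 0 ≤ C) (hC : ∀ i, ∀ I ∈ (F i).supp, |(F i).coeff I| ≤ C)
    (a : Fin n → ℝ) (s : ℝ) (hs0 : 0 ≤ s) (hs : ∀ j, -s ≤ a j)
    (hT : ∀ i, (∀ I ∈ (F i).supp, ∃ I' ∈ (F i).supp, I' ≠ I ∧ (F i).mono I' a ≤ (F i).mono I a) ∨
      ∀ I ∈ (F i).supp, C + d * ((3 * d : ℝ) ^ (min n k + 1) * (s + C + 1)) < (F i).mono I a) :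
    ∃ a' : Fin n → WithTop ℝ, ∀ j, (F j).IsRootT a' := by
  have hd1 : (1 : ℝ) ≤ d := by exact_mod_cast hd
  have h3 : (1 : ℝ) ≤ 3 * d := by linarith
  have hB₀ : 0 < s + C + 1 := by linarith
  choose β hβ1 hβ2 hβ3 hβ4 using fun i => exists_level (F i).supp (F i).supp_nonempty a (s + C + 1)
  obtain ⟨l, hl, hgap⟩ := exists_gap hd a (s + C + 1) hB₀ β hβ4
  set B : ℝ := (3 * d : ℝ) ^ (l + 1) * (s + C + 1) with hB
  have hBge : s + C + 1 ≤ B := by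
    have := mul_le_mul_of_nonneg_right (one_le_pow₀ h3 (n := l + 1)) hB₀.le
    linarith
  have hBle : B ≤ (3 * d : ℝ) ^ (min n k + 1) * (s + C + 1) :=
    mul_le_mul_of_nonneg_right (pow_le_pow_right₀ h3 (by omega)) hB₀.le
  set a' : Fin n → WithTop ℝ := fun j => if a j ≤ B then (a j : WithTop ℝ) else ⊤ with ha'
  have mono_fin : ∀ (f : TropPoly n) (I : Exp n), (∀ j, I j ≠ 0 → a j ≤ B) →
      f.monoT I a' = (f.mono I a : WithTop ℝ) := by
    intro f I hI
    unfold TropPoly.monoT TropPoly.mono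
    rw [WithTop.coe_add, WithTop.coe_sum]
    congr 1
    refine Finset.sum_congr rfl fun j _ => ?_
    by_cases e : I j = 0
    · simp [e]
    · simp only [ha']
      rw [if_pos (hI j e), ← WithTop.coe_nsmul, nsmul_eq_mul]
  have mono_top : ∀ (f : TropPoly n) (I : Exp n), (¬ ∀ j, I j ≠ 0 → a j ≤ B) →
      f.monoT I a' = ⊤ := by
    intro f I hI
    push Not at hI
    obtain ⟨j, hj, hlt⟩ := hI
    unfold TropPoly.monoT
    have h1 : ∑ j, (I j) • a' j = ⊤ := by
      rw [WithTop.sum_eq_top]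
      refine ⟨j, Finset.mem_univ j, ?_⟩
      simp only [ha']
      rw [if_neg (not_le.2 hlt)]
      obtain ⟨p, hp⟩ := Nat.exists_eq_succ_of_ne_zero hj
      rw [hp, Nat.succ_eq_add_one, add_nsmul, one_nsmul, WithTop.add_top]
    rw [h1, WithTop.add_top]
  refine ⟨a', fun i => ?_⟩
  by_cases hS : ∃ I ∈ (F i).supp, ∀ j, I j ≠ 0 → a j ≤ B
  · right
    obtain ⟨I₁, hI₁, hI₁S⟩ := hS
    have hroot : ∀ I ∈ (F i).supp, ∃ I' ∈ (F i).supp, I' ≠ I ∧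
        (F i).mono I' a ≤ (F i).mono I a := by
      rcases hT i with h | h
      · exact h
      · exfalso
        have h1 := h I₁ hI₁
        unfold TropPoly.mono at h1
        have h2 := inner_le ((expDeg_le_of_mem hI₁).trans (hdeg i)) (by linarith) hI₁S
        have h4 := (abs_le.1 (hC i I₁ hI₁)).2
        have h5 : d * B ≤ d * ((3 * d : ℝ) ^ (min n k + 1) * (s + C + 1)) :=
          mul_le_mul_of_nonneg_left hBle (by linarith)
        linarith
    have hβB : β i ≤ B := hβ3 i I₁ hI₁ B hBge hI₁S
    have hβB2 : 3 * d * β i ≤ B := by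
      rcases hgap i with h | h
      · linarith
      · exact h
    obtain ⟨I₂, hI₂, hI₂S⟩ := hβ2 i
    have hβ0 : 0 ≤ β i := by linarith [hβ1 i]
    have hI₂v : (F i).mono I₂ a ≤ C + d * β i := by
      unfold TropPoly.mono
      have h2 := inner_le ((expDeg_le_of_mem hI₂).trans (hdeg i)) hβ0 hI₂S
      have h4 := (abs_le.1 (hC i I₂ hI₂)).2
      linarith
    have hnonS : ∀ I ∈ (F i).supp, (¬ ∀ j, I j ≠ 0 → a j ≤ B) →
        C + d * β i < (F i).mono I a := by
      intro I hI hn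
      push Not at hn
      obtain ⟨j, hj, hlt⟩ := hn
      have h1 := lt_inner ((expDeg_le_of_mem hI).trans (hdeg i)) hs0 hs hj hlt
      have h4 := (abs_le.1 (hC i I hI)).1
      unfold TropPoly.mono
      have h5 : d * (s + C + 1) ≤ d * β i := mul_le_mul_of_nonneg_left (hβ1 i) (by linarith)
      have h6 : 0 ≤ (d - 1 : ℝ) * C := mul_nonneg (by linarith) hC0
      have h7 : 0 ≤ (d : ℝ) * s := mul_nonneg (by linarith) hs0
      nlinarith
    obtain ⟨I₃, hI₃, hmin⟩ := (F i).supp.exists_min_image (fun I => (F i).mono I a) ⟨I₁, hI₁⟩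
    have hS' : ∀ I ∈ (F i).supp, (F i).mono I a ≤ C + d * β i → ∀ j, I j ≠ 0 → a j ≤ B := by
      intro I hI hle
      by_contra hn
      exact absurd (hnonS I hI hn) (not_lt.2 hle)
    have hI₃v : (F i).mono I₃ a ≤ C + d * β i := (hmin I₂ hI₂).trans hI₂v
    obtain ⟨I₄, hI₄, hne, hle⟩ := hroot I₃ hI₃
    have hI₃S := hS' I₃ hI₃ hI₃v
    have hI₄S := hS' I₄ hI₄ (hle.trans hI₃v)
    have heq : (F i).mono I₄ a = (F i).mono I₃ a := le_antisymm hle (hmin I₄ hI₄)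
    have hev : (F i).evalT a' = ((F i).mono I₃ a : WithTop ℝ) := by
      unfold TropPoly.evalT
      apply le_antisymm
      · rw [← mono_fin (F i) I₃ hI₃S]
        exact Finset.inf_le hI₃
      · apply Finset.le_inf
        intro I hI
        by_cases hIS : ∀ j, I j ≠ 0 → a j ≤ B
        · rw [mono_fin (F i) I hIS, WithTop.coe_le_coe]
          exact hmin I hI
        · rw [mono_top (F i) I hIS]
          exact le_top
    refine ⟨I₃, hI₃, I₄, hI₄, hne.symm, ?_, ?_⟩
    · rw [hev, mono_fin (F i) I₃ hI₃S]
    · rw [hev, mono_fin (F i) I₄ hI₄S, heq]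
  · left
    push Not at hS
    unfold TropPoly.evalT
    rw [Finset.inf_eq_top_iff]
    intro I hI
    apply mono_top
    push Not
    exact hS I hI

/-! ### The Macaulay rows -/

lemma row_ok {n k N : ℕ} {F : Fin k → TropPoly n} {y : Exp n → WithTop ℝ}
    (hy : IsMacaulaySolT F N y) (i : Fin k) (J : Exp n) (hJ : expDeg J + (F i).deg ≤ N)
    (I : Exp n) (hI : I ∈ (F i).supp) (hyI : y (J + I) ≠ ⊤) :
    ∃ I' ∈ (F i).supp, I' ≠ I ∧ y (J + I') ≠ ⊤ ∧
      (F i).coeff I' + (y (J + I')).untopD 0 ≤ (F i).coeff I + (y (J + I)).untopD 0 := by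
  have hsc : ∀ I ∈ (F i).supp, shiftCoeff (F i) J (J + I) = ((F i).coeff I : WithTop ℝ) := by
    intro I hI
    unfold shiftCoeff
    have e : J + I - J = I := add_tsub_cancel_left J I
    rw [e, if_pos ⟨le_self_add, hI⟩]
  have hdegI : expDeg (J + I) ≤ N := by
    rw [expDeg_add]
    exact (Nat.add_le_add_left (expDeg_le_of_mem hI) _).trans hJ
  have hfin : macVal (F i) J y (J + I) ≠ ⊤ := by
    unfold macVal
    rw [hsc I hI]
    exact WithTop.add_ne_top.2 ⟨WithTop.coe_ne_top, hyI⟩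
  rcases hy i J hJ with h | ⟨I₁, I₂, hne, hd1, hd2, heq, hmin⟩
  · exact absurd (h _ hdegI) hfin
  · have main : ∀ K : Exp n, K ≠ J + I → macVal (F i) J y K ≤ macVal (F i) J y (J + I) →
        ∃ I' ∈ (F i).supp, I' ≠ I ∧ y (J + I') ≠ ⊤ ∧
          (F i).coeff I' + (y (J + I')).untopD 0 ≤ (F i).coeff I + (y (J + I)).untopD 0 := by
      intro K hK hle
      have hKf : macVal (F i) J y K ≠ ⊤ := ne_top_of_le_ne_top hfin hle
      have hcond : J ≤ K ∧ K - J ∈ (F i).supp := by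
        by_contra hn
        apply hKf
        unfold macVal shiftCoeff
        rw [if_neg hn, WithTop.top_add]
      have hKe : J + (K - J) = K := add_tsub_cancel_of_le hcond.1
      have hyK : y (J + (K - J)) ≠ ⊤ := by
        rw [hKe]
        exact (WithTop.add_ne_top.1 hKf).2
      refine ⟨K - J, hcond.2, ?_, hyK, ?_⟩
      · intro e
        apply hK
        rw [← e, hKe]
      · rw [← hKe] at hle
        unfold macVal at hle
        rw [hsc _ hcond.2, hsc _ hI] at hle
        obtain ⟨u, hu⟩ := WithTop.ne_top_iff_exists.1 hyK
        obtain ⟨v, hv⟩ := WithTop.ne_top_iff_exists.1 hyI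
        rw [← hu, ← hv] at hle ⊢
        simp only [WithTop.untopD_coe]
        exact_mod_cast hle
    by_cases h1 : I₁ = J + I
    · refine main I₂ (fun h2 => hne (h1.trans h2.symm)) ?_
      rw [← heq]
      exact hmin _ hdegI
    · exact main I₁ h1 (hmin _ hdegI)

/-- The shift used in the auxiliary polynomials. -/
def shv {n : ℕ} (D : ℕ) : Option (Fin n) → Exp n
  | none => 0
  | some j => fun i => if i = j then D else 0

lemma expDeg_shv {n : ℕ} (D : ℕ) (o : Option (Fin n)) : expDeg (shv D o) ≤ D := by
  cases o with
  | none => simp [shv, expDeg]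
  | some j => simp [shv, expDeg]

/-- The auxiliary polynomials `x_j^D f_i ⊕ ω ⊙ f_{i₀}`. -/
noncomputable def auxG {n k : ℕ} (F : Fin k → TropPoly n) (i₀ : Fin k) (D : ℕ) (w : ℝ)
    (p : Fin k × Option (Fin n)) : Finset (Exp n × ℝ) :=
  (F p.1).supp.image (fun I => (I + shv D p.2, (F p.1).coeff I)) ∪
    (F i₀).supp.image (fun I => (I, w + (F i₀).coeff I))

lemma tval_shift {n : ℕ} (I v : Exp n) (c : ℝ) (a : Fin n → ℝ) :
    tval (I + v, c) a = c + ∑ j, (I j : ℝ) * a j + ∑ j, (v j : ℝ) * a j := by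
  unfold tval
  simp only [Pi.add_apply, Nat.cast_add, add_mul, Finset.sum_add_distrib]
  ring

lemma aux_root {n k d : ℕ} (F : Fin k → TropPoly n) (hdeg : ∀ j, (F j).deg ≤ d) (i₀ : Fin k)
    (D : ℕ) (w C : ℝ) (hC : ∀ i, ∀ I ∈ (F i).supp, |(F i).coeff I| ≤ C)
    (a : Fin n → ℝ) (ha : ∀ p, TRoot (auxG F i₀ D w p) a) (s : ℝ) (hs0 : 0 ≤ s)
    (hs : ∀ j, -s ≤ a j) (o : Option (Fin n))
    (ho : ∑ j, ((shv D o : Exp n) j : ℝ) * a j = -(D * s)) (i : Fin k) :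
    (∀ I ∈ (F i).supp, ∃ I' ∈ (F i).supp, I' ≠ I ∧ (F i).mono I' a ≤ (F i).mono I a) ∨
      ∀ I ∈ (F i).supp, w - C - d * s + D * s ≤ (F i).mono I a := by
  by_contra hcon
  push Not at hcon
  obtain ⟨⟨I, hI, hIlt⟩, I₁, hI₁, hI₁v⟩ := hcon
  have hmemI : (I + shv D o, (F i).coeff I) ∈ auxG F i₀ D w (i, o) :=
    Finset.mem_union_left _ (Finset.mem_image.2 ⟨I, hI, rfl⟩)
  obtain ⟨t', ht', hne, hle⟩ := ha (i, o) _ hmemI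
  rw [tval_shift, ho] at hle
  rcases Finset.mem_union.1 ht' with h | h
  · obtain ⟨I', hI', rfl⟩ := Finset.mem_image.1 h
    simp only at hne hle
    rw [tval_shift, ho] at hle
    have hne' : I' ≠ I := by
      rintro rfl
      exact hne rfl
    have := hIlt I' hI' hne'
    unfold TropPoly.mono at this
    linarith
  · obtain ⟨I', hI', rfl⟩ := Finset.mem_image.1 h
    unfold tval at hle
    simp only at hle
    have h1 := le_inner ((expDeg_le_of_mem hI').trans (hdeg i₀)) hs0 hs
    have h2 := (abs_le.1 (hC i₀ I' hI')).1
    have h3 : (F i).mono I a ≤ (F i).mono I₁ a := by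
      by_cases e : I₁ = I
      · rw [e]
      · exact (hIlt I₁ hI₁ e).le
    have h4 : (F i).mono I a = (F i).coeff I + ∑ j, (I j : ℝ) * a j := rfl
    linarith

lemma exists_neg_part {n : ℕ} (D : ℕ) (a : Fin n → ℝ) :
    ∃ s : ℝ, 0 ≤ s ∧ (∀ j, -s ≤ a j) ∧ ∃ o : Option (Fin n),
      ∑ j, ((shv D o : Exp n) j : ℝ) * a j = -(D * s) := by
  by_cases h : ∀ j, 0 ≤ a j
  · exact ⟨0, le_rfl, by simpa using h, none, by simp [shv]⟩
  · push Not at h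
    obtain ⟨j₁, hj₁⟩ := h
    obtain ⟨j, _, hj⟩ := Finset.univ.exists_min_image a ⟨j₁, Finset.mem_univ _⟩
    refine ⟨-a j, ?_, ?_, some j, ?_⟩
    · linarith [hj j₁ (Finset.mem_univ _)]
    · intro i
      simpa using hj i (Finset.mem_univ _)
    · simp [shv]

lemma exists_coeff_bound {n k : ℕ} (F : Fin k → TropPoly n) :
    ∃ C : ℝ, 0 ≤ C ∧ ∀ i, ∀ I ∈ (F i).supp, |(F i).coeff I| ≤ C := by
  refine ⟨∑ i, ∑ I ∈ (F i).supp, |(F i).coeff I|,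
    Finset.sum_nonneg fun i _ => Finset.sum_nonneg fun I _ => abs_nonneg _, fun i I hI => ?_⟩
  refine (Finset.single_le_sum (f := fun I => |(F i).coeff I|)
    (fun _ _ => abs_nonneg _) hI).trans ?_
  exact Finset.single_le_sum (f := fun i => ∑ I ∈ (F i).supp, |(F i).coeff I|)
    (fun i _ => Finset.sum_nonneg fun I _ => abs_nonneg _) (Finset.mem_univ i)

lemma aux_rows {n k d N : ℕ} {F : Fin k → TropPoly n} (hdeg : ∀ j, (F j).deg ≤ d)
    {y : Exp n → WithTop ℝ} (hy : IsMacaulaySolT F N y) (i₀ : Fin k) (D : ℕ) (w : ℝ)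
    (p : Fin k × Option (Fin n)) (J : Exp n) (hJ : expDeg J + D + d ≤ N)
    (t : Exp n × ℝ) (ht : t ∈ auxG F i₀ D w p) (hyt : y (J + t.1) ≠ ⊤) :
    ∃ t' ∈ auxG F i₀ D w p, t'.1 ≠ t.1 ∧ y (J + t'.1) ≠ ⊤ ∧
      t'.2 + (y (J + t'.1)).untopD 0 ≤ t.2 + (y (J + t.1)).untopD 0 := by
  rcases Finset.mem_union.1 ht with h | h
  · obtain ⟨I, hI, rfl⟩ := Finset.mem_image.1 h
    simp only at hyt ⊢
    have e : ∀ I : Exp n, J + (I + shv D p.2) = (J + shv D p.2) + I := fun I => by abel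
    rw [e] at hyt
    have h1 := expDeg_shv (n := n) D p.2
    have h2 := hdeg p.1
    obtain ⟨I', hI', hne, hf, hle⟩ := row_ok hy p.1 (J + shv D p.2)
      (by rw [expDeg_add]; omega) I hI hyt
    refine ⟨(I' + shv D p.2, (F p.1).coeff I'),
      Finset.mem_union_left _ (Finset.mem_image.2 ⟨I', hI', rfl⟩), ?_, ?_, ?_⟩
    · exact fun h => hne (add_right_cancel h)
    · simp only; rw [e]; exact hf
    · simp only; rw [e, e]; exact hle
  · obtain ⟨I, hI, rfl⟩ := Finset.mem_image.1 h
    simp only at hyt ⊢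
    have h2 := hdeg i₀
    obtain ⟨I', hI', hne, hf, hle⟩ := row_ok hy i₀ J (by omega) I hI hyt
    refine ⟨(I', w + (F i₀).coeff I'),
      Finset.mem_union_right _ (Finset.mem_image.2 ⟨I', hI', rfl⟩), hne, hf, ?_⟩
    simp only
    linarith

lemma degree_arith (n k d m : ℕ) (hk : 1 ≤ k) (hd : 1 ≤ d) :
    (k * (n + 1)) * ((d + d * (3 * d) ^ (m + 1)) + d) + n + (d + d * (3 * d) ^ (m + 1)) + d
      ≤ 2 * (n + 2) ^ 2 * k * (4 * d) ^ (m + 2) := by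
  set P := (4 * d) ^ (m + 2) with hP
  have h1 : d * (3 * d) ^ (m + 1) ≤ P := by
    calc d * (3 * d) ^ (m + 1) ≤ (4 * d) * (4 * d) ^ (m + 1) := by gcongr <;> omega
      _ = P := by rw [hP]; ring
  have h2 : 2 * d ≤ P := by
    calc 2 * d ≤ (4 * d) ^ 1 := by rw [pow_one]; omega
      _ ≤ P := Nat.pow_le_pow_right (by omega) (by omega)
  have hQ : (d + d * (3 * d) ^ (m + 1)) + d ≤ 2 * P := by omega
  have hP1 : 1 ≤ P := by omega
  have hkP : P ≤ k * P := Nat.le_mul_of_pos_left _ hk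
  calc (k * (n + 1)) * ((d + d * (3 * d) ^ (m + 1)) + d) + n + (d + d * (3 * d) ^ (m + 1)) + d
      ≤ (k * (n + 1)) * (2 * P) + n * (k * P) + 2 * (k * P) := by
        have := Nat.mul_le_mul_left (k * (n + 1)) hQ
        have h5 : n * 1 ≤ n * (k * P) := Nat.mul_le_mul_left n (by omega)
        omega
    _ ≤ (k * (n + 1)) * (2 * P) + n * (k * P) + 2 * (k * P)
          + k * P * (2 * n ^ 2 + 5 * n + 4) := Nat.le_add_right _ _
    _ = 2 * (n + 2) ^ 2 * k * P := by ring

lemma root_of_sol {n k d : ℕ} (hk : 1 ≤ k) (hd : 1 ≤ d)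
    (F : Fin k → TropPoly n) (hdeg : ∀ j : Fin k, (F j).deg ≤ d) (y : Exp n → WithTop ℝ)
    (hy0 : y 0 = 0) (hy : IsMacaulaySolT F (2 * (n + 2) ^ 2 * k * (4 * d) ^ (min n k + 2)) y) :
    ∃ a : Fin n → WithTop ℝ, ∀ j : Fin k, (F j).IsRootT a := by
  by_contra hno
  -- some polynomial has a constant term
  have hconst : ∃ i₀, (0 : Exp n) ∈ (F i₀).supp := by
    by_contra hc
    push Not at hc
    apply hno
    refine ⟨fun _ => ⊤, fun i => Or.inl ?_⟩
    unfold TropPoly.evalT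
    rw [Finset.inf_eq_top_iff]
    intro I hI
    have hI0 : I ≠ 0 := by
      rintro rfl
      exact hc i hI
    obtain ⟨j, hj⟩ := Function.ne_iff.1 hI0
    unfold TropPoly.monoT
    have h1 : ∑ j, (I j) • (⊤ : WithTop ℝ) = ⊤ := by
      rw [WithTop.sum_eq_top]
      refine ⟨j, Finset.mem_univ j, ?_⟩
      obtain ⟨p, hp⟩ := Nat.exists_eq_succ_of_ne_zero hj
      rw [hp, Nat.succ_eq_add_one, add_nsmul, one_nsmul, WithTop.add_top]
    rw [h1, WithTop.add_top]
  obtain ⟨i₀, hi₀⟩ := hconst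
  obtain ⟨C, hC0, hC⟩ := exists_coeff_bound F
  set D : ℕ := d + d * (3 * d) ^ (min n k + 1) with hD
  set w : ℝ := 2 * C + d * ((3 * d : ℝ) ^ (min n k + 1) * (C + 1)) + 1 with hw
  have hnoroot : ∀ a, ∃ p, ¬ TRoot (auxG F i₀ D w p) a := by
    intro a
    by_contra hall
    push Not at hall
    obtain ⟨s, hs0, hs, o, ho⟩ := exists_neg_part D a
    apply hno
    refine core hd F hdeg C hC0 hC a s hs0 hs fun i => ?_
    rcases aux_root F hdeg i₀ D w C hC a hall s hs0 hs o ho i with h | h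
    · exact Or.inl h
    · refine Or.inr fun I hI => lt_of_lt_of_le ?_ (h I hI)
      rw [hw, hD]
      push_cast
      ring_nf
      linarith
  have harith := degree_arith n k d (min n k) hk hd
  rw [← hD] at harith
  have hfin := toric_case (auxG F i₀ D w)
    (fun p => ⟨(0, w + (F i₀).coeff 0),
      Finset.mem_union_right _ (Finset.mem_image.2 ⟨0, hi₀, rfl⟩), rfl⟩) (D + d)
    (by
      intro p t ht
      rcases Finset.mem_union.1 ht with h | h
      · obtain ⟨I, hI, rfl⟩ := Finset.mem_image.1 h
        simp only [expDeg_add]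
        have h1 := expDeg_shv (n := n) D p.2
        have h2 := (expDeg_le_of_mem hI).trans (hdeg p.1)
        omega
      · obtain ⟨I, hI, rfl⟩ := Finset.mem_image.1 h
        have h2 := (expDeg_le_of_mem hI).trans (hdeg i₀)
        show expDeg I ≤ _
        omega)
    hnoroot {q | y q ≠ ⊤} (fun q => (y q).untopD 0)
    (by
      intro p J hJ t ht hV
      have hcard : Fintype.card (Fin k × Option (Fin n)) = k * (n + 1) := by simp
      rw [hcard] at hJ
      exact aux_rows hdeg hy i₀ D w p J (by omega) t ht hV)
  apply hfin
  show y 0 ≠ ⊤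
  rw [hy0]
  exact WithTop.zero_ne_top

lemma sol_of_root {n k : ℕ} (F : Fin k → TropPoly n) (N : ℕ) (a : Fin n → WithTop ℝ)
    (ha : ∀ j : Fin k, (F j).IsRootT a) :
    ∃ y : Exp n → WithTop ℝ, y 0 = 0 ∧ IsMacaulaySolT F N y := by
  refine ⟨fun I => ∑ j, I j • a j, by simp, ?_⟩
  intro i J hJ
  have hval : ∀ I ∈ (F i).supp, macVal (F i) J (fun I => ∑ j, I j • a j) (J + I)
      = (∑ j, J j • a j) + (F i).monoT I a := by
    intro I hI
    unfold macVal shiftCoeff TropPoly.monoT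
    have e : J + I - J = I := add_tsub_cancel_left J I
    rw [e, if_pos ⟨le_self_add, hI⟩]
    simp only [Pi.add_apply, add_nsmul, Finset.sum_add_distrib]
    rw [add_left_comm]
  have hge : ∀ I : Exp n, (∑ j, J j • a j) + (F i).evalT a ≤
      macVal (F i) J (fun I => ∑ j, I j • a j) I := by
    intro K
    by_cases hcond : J ≤ K ∧ K - J ∈ (F i).supp
    · have hKe : J + (K - J) = K := add_tsub_cancel_of_le hcond.1
      rw [← hKe, hval _ hcond.2]
      exact add_le_add_right (Finset.inf_le hcond.2) _
    · unfold macVal shiftCoeff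
      rw [if_neg hcond, WithTop.top_add]
      exact le_top
  rcases ha i with h | ⟨I₁, hI₁, I₂, hI₂, hne, h1, h2⟩
  · left
    intro I _
    have := hge I
    rw [h, WithTop.add_top] at this
    exact top_le_iff.1 this
  · right
    refine ⟨J + I₁, J + I₂, fun h => hne (add_left_cancel h), ?_, ?_, ?_, ?_⟩
    · rw [expDeg_add]
      exact (Nat.add_le_add_left (expDeg_le_of_mem hI₁) _).trans hJ
    · rw [expDeg_add]
      exact (Nat.add_le_add_left (expDeg_le_of_mem hI₂) _).trans hJ
    · rw [hval _ hI₁, hval _ hI₂, h1, h2]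
    · intro I _
      rw [hval _ hI₁, h1]
      exact hge I

/-- **Tropical dual Nullstellensatz over ℝ∞** : a system `F = {f_1, …, f_k}` of tropical
polynomials in `n` variables over `ℝ∞`, each of degree at most `d ≥ 1`, has a root iff the
non-homogeneous Macaulay tropical linear system `M_N ⊙ (0, y)` with
`N = 2(n+2)²·k·(4d)^{min(n,k)+2}` has a solution (i.e. a solution whose coordinate at the
zero exponent vector is `0`). -/
theorem tropical_dual_nullstellensatz_inf (n k d : ℕ) (hk : 1 ≤ k) (hd : 1 ≤ d)
    (F : Fin k → TropPoly n) (hdeg : ∀ j : Fin k, (F j).deg ≤ d) :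
    (∃ a : Fin n → WithTop ℝ, ∀ j : Fin k, (F j).IsRootT a) ↔
      (∃ y : Exp n → WithTop ℝ, y 0 = 0 ∧
        IsMacaulaySolT F (2 * (n + 2) ^ 2 * k * (4 * d) ^ (min n k + 2)) y) := by
  constructor
  · rintro ⟨a, ha⟩
    exact sol_of_root F _ a ha
  · rintro ⟨y, hy0, hy⟩
    exact root_of_sol hk hd F hdeg y hy0 hy
end

section
/- Let F = {f_1, …, f_k} (k ≥ 1) be a system of tropical polynomials in n variables over ℝ. Then F has a root in ℝ^n if and only if the infinite Macaulay tropical linear system of F has a solution. -/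
open scoped Classical

/-- `y` is a solution of the infinite Macaulay tropical linear system of `F` over `ℝ`:
for every `j` and every `J ∈ ℕ^n`, the minimum over all `I ∈ ℕ^n` of
`c_{f_j}(I-J) + y_I` is attained for at least two distinct `I`. -/
noncomputable def IsInfMacaulaySol {n k : ℕ} (F : Fin k → TropPoly n)
    (y : Exp n → ℝ) : Prop :=
  ∀ j : Fin k, ∀ J : Exp n,
    ∃ I₁ I₂ : Exp n, I₁ ≠ I₂ ∧
      macVal (F j) J (fun I => (y I : WithTop ℝ)) I₁ =
        macVal (F j) J (fun I => (y I : WithTop ℝ)) I₂ ∧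
      ∀ I : Exp n,
        macVal (F j) J (fun I => (y I : WithTop ℝ)) I₁ ≤
          macVal (F j) J (fun I => (y I : WithTop ℝ)) I

/-! ### Helpers -/

/-- The pairing of an exponent with a point. -/
noncomputable def tdnPair {n : ℕ} (I : Exp n) (a : Fin n → ℝ) : ℝ := ∑ j, (I j : ℝ) * a j

/-- A strictly convex function of linear growth. -/
noncomputable def tdnS {n : ℕ} (a : Fin n → ℝ) : ℝ := ∑ j, Real.sqrt (1 + a j ^ 2)

lemma tdn_sqrt_strict (x y α β : ℝ) (hxy : x ≠ y) (hα : 0 < α) (hβ : 0 < β) (h : α + β = 1) :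
    Real.sqrt (1 + (α * x + β * y) ^ 2) <
      α * Real.sqrt (1 + x ^ 2) + β * Real.sqrt (1 + y ^ 2) := by
  have hX : 0 < Real.sqrt (1 + x ^ 2) := Real.sqrt_pos.2 (by positivity)
  have hY : 0 < Real.sqrt (1 + y ^ 2) := Real.sqrt_pos.2 (by positivity)
  have hX2 : Real.sqrt (1 + x ^ 2) ^ 2 = 1 + x ^ 2 := Real.sq_sqrt (by positivity)
  have hY2 : Real.sqrt (1 + y ^ 2) ^ 2 = 1 + y ^ 2 := Real.sq_sqrt (by positivity)
  set X := Real.sqrt (1 + x ^ 2)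
  set Y := Real.sqrt (1 + y ^ 2)
  have hd : 0 < (x - y) ^ 2 := by
    have : x - y ≠ 0 := sub_ne_zero.2 hxy
    positivity
  have key : 1 + x * y < X * Y := by
    apply lt_of_pow_lt_pow_left₀ 2 (by positivity)
    rw [mul_pow, hX2, hY2]
    nlinarith
  rw [Real.sqrt_lt' (by positivity)]
  have hab : 0 < α * β := by positivity
  have e1 : (1 : ℝ) = α ^ 2 + β ^ 2 + 2 * (α * β) := by
    have : (α + β) ^ 2 = 1 := by rw [h]; norm_num
    nlinarith
  have e2 : (α * X + β * Y) ^ 2 =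
      α ^ 2 * (1 + x ^ 2) + β ^ 2 * (1 + y ^ 2) + 2 * (α * β) * (X * Y) := by
    rw [← hX2, ← hY2]; ring
  rw [e2]
  have := mul_lt_mul_of_pos_left key hab
  nlinarith

lemma tdnS_strictConvex {n : ℕ} : StrictConvexOn ℝ Set.univ (tdnS (n := n)) := by
  refine ⟨convex_univ, ?_⟩
  intro x _ y _ hxy α β hα hβ h
  obtain ⟨i, hi⟩ := Function.ne_iff.1 hxy
  simp only [tdnS, smul_eq_mul, Pi.add_apply, Pi.smul_apply]
  rw [Finset.mul_sum, Finset.mul_sum, ← Finset.sum_add_distrib]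
  apply Finset.sum_lt_sum
  · intro j _
    by_cases hj : x j = y j
    · rw [hj, ← add_mul, ← add_mul, h, one_mul, one_mul]
    · exact (tdn_sqrt_strict _ _ _ _ hj hα hβ h).le
  · exact ⟨i, Finset.mem_univ i, tdn_sqrt_strict _ _ _ _ hi hα hβ h⟩

lemma tdnS_nonneg {n : ℕ} (a : Fin n → ℝ) : 0 ≤ tdnS a :=
  Finset.sum_nonneg fun _ _ => Real.sqrt_nonneg _

lemma tdnS_continuous {n : ℕ} : Continuous (tdnS (n := n)) := by
  unfold tdnS; fun_prop

lemma tdnPair_continuous {n : ℕ} (I : Exp n) : Continuous (tdnPair I) := by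
  unfold tdnPair; fun_prop

lemma norm_le_tdnS {n : ℕ} (a : Fin n → ℝ) : ‖a‖ ≤ tdnS a := by
  rw [pi_norm_le_iff_of_nonneg (tdnS_nonneg a)]
  intro i
  calc ‖a i‖ ≤ Real.sqrt (1 + a i ^ 2) := by
        rw [Real.norm_eq_abs]; apply Real.abs_le_sqrt; linarith
    _ ≤ _ := Finset.single_le_sum (f := fun i => Real.sqrt (1 + a i ^ 2))
        (fun _ _ => Real.sqrt_nonneg _) (Finset.mem_univ i)

lemma tdnS_single {n : ℕ} (i : Fin n) (t : ℝ) : tdnS (Pi.single i t) ≤ n + |t| := by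
  have h : ∀ j : Fin n, Real.sqrt (1 + (Pi.single i t : Fin n → ℝ) j ^ 2) ≤
      1 + (if j = i then |t| else 0) := by
    intro j
    by_cases hj : j = i
    · subst hj
      simp only [Pi.single_eq_same, if_true]
      rw [Real.sqrt_le_left (by positivity)]
      nlinarith [abs_nonneg t, sq_abs t]
    · simp [hj]
  refine (Finset.sum_le_sum fun j _ => h j).trans ?_
  rw [Finset.sum_add_distrib]
  simp

lemma tdnPair_single {n : ℕ} (I : Exp n) (i : Fin n) (t : ℝ) :
    tdnPair I (Pi.single i t) = I i * t := by
  unfold tdnPair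
  rw [Finset.sum_eq_single i]
  · simp
  · intro b _ hb; simp [hb]
  · simp

lemma tdnPair_add {n : ℕ} (I J : Exp n) (a : Fin n → ℝ) :
    tdnPair (I + J) a = tdnPair I a + tdnPair J a := by
  simp [tdnPair, add_mul, Finset.sum_add_distrib]

lemma tdnPair_comb {n : ℕ} (I : Exp n) (a b : Fin n → ℝ) (α β : ℝ) :
    tdnPair I (α • a + β • b) = α * tdnPair I a + β * tdnPair I b := by
  simp only [tdnPair, Finset.mul_sum, ← Finset.sum_add_distrib]
  refine Finset.sum_congr rfl fun j _ => ?_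
  simp; ring

lemma tdn_mono_eq {n : ℕ} (f : TropPoly n) (I : Exp n) (a : Fin n → ℝ) :
    f.mono I a = f.coeff I + tdnPair I a := rfl

lemma tdn_mono_continuous {n : ℕ} (f : TropPoly n) (I : Exp n) : Continuous (f.mono I) := by
  unfold TropPoly.mono; fun_prop

lemma tdn_eval_le {n : ℕ} (f : TropPoly n) {I : Exp n} (hI : I ∈ f.supp) (a : Fin n → ℝ) :
    f.eval a ≤ f.mono I a := Finset.inf'_le _ hI

lemma tdn_eval_continuous {n : ℕ} (f : TropPoly n) : Continuous f.eval := by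
  unfold TropPoly.eval
  exact Continuous.finset_inf'_apply f.supp_nonempty fun I _ => tdn_mono_continuous f I

lemma tdn_eval_concave {n : ℕ} (f : TropPoly n) (a b : Fin n → ℝ) (α β : ℝ)
    (hα : 0 ≤ α) (hβ : 0 ≤ β) (h : α + β = 1) :
    α * f.eval a + β * f.eval b ≤ f.eval (α • a + β • b) := by
  refine Finset.le_inf' _ _ fun I hI => ?_
  have h1 := mul_le_mul_of_nonneg_left (tdn_eval_le f hI a) hα
  have h2 := mul_le_mul_of_nonneg_left (tdn_eval_le f hI b) hβ
  have h3 : f.coeff I = α * f.coeff I + β * f.coeff I := by rw [← add_mul, h, one_mul]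
  rw [tdn_mono_eq] at h1 h2 ⊢
  rw [tdnPair_comb]
  linarith

/-- The objective function. -/
noncomputable def tdnPhi {n k : ℕ} (F : Fin k → TropPoly n) (T : Exp n) (l : ℝ) (x : Exp n)
    (a : Fin n → ℝ) : ℝ :=
  (∑ j, (F j).eval a) + tdnPair T a - l * tdnS a - tdnPair x a

lemma tdnPhi_continuous {n k : ℕ} (F : Fin k → TropPoly n) (T : Exp n) (l : ℝ) (x : Exp n) :
    Continuous (tdnPhi F T l x) := by
  unfold tdnPhi
  have h1 := fun j => tdn_eval_continuous (F j)
  have h2 := tdnPair_continuous T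
  have h3 := tdnPair_continuous x
  have h4 := tdnS_continuous (n := n)
  fun_prop

lemma tdnPhi_attains {n k : ℕ} (F : Fin k → TropPoly n) (T : Exp n) (l l' : ℝ) (x : Exp n)
    (hl : l' < l) (C : ℝ) (hC : ∀ a, tdnPhi F T l' x a ≤ C) :
    ∃ a, ∀ b, tdnPhi F T l x b ≤ tdnPhi F T l x a := by
  have hle : ∀ a, tdnPhi F T l x a ≤ C - (l - l') * ‖a‖ := by
    intro a
    have h1 := hC a
    have h2 := mul_le_mul_of_nonneg_left (norm_le_tdnS a) (sub_pos.2 hl).le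
    unfold tdnPhi at h1 ⊢
    nlinarith
  apply (tdnPhi_continuous F T l x).exists_forall_ge
  refine Filter.tendsto_atBot_mono hle ?_
  have h1 : Filter.Tendsto (fun a : Fin n → ℝ => (l - l') * ‖a‖) (Filter.cocompact _)
      Filter.atTop := (tendsto_norm_cocompact_atTop).const_mul_atTop (sub_pos.2 hl)
  simpa [sub_eq_add_neg] using
    Filter.tendsto_atBot_add_const_left _ C (Filter.tendsto_neg_atTop_atBot.comp h1)

lemma tdn_good {n k : ℕ} (F : Fin k → TropPoly n) (T : Exp n) :
    ∃ l : ℝ, 0 < l ∧ l < 1 ∧ ∀ x : Exp n, (∃ C, ∀ a, tdnPhi F T l x a ≤ C) →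
      ∃ a, ∀ b, tdnPhi F T l x b ≤ tdnPhi F T l x a := by
  let Bad : Exp n → Set ℝ := fun x => {l | (∃ C, ∀ a, tdnPhi F T l x a ≤ C) ∧
      ¬ ∃ a, ∀ b, tdnPhi F T l x b ≤ tdnPhi F T l x a}
  have hsub : ∀ x, (Bad x).Subsingleton := by
    rintro x l ⟨⟨C, hC⟩, h2⟩ l' ⟨⟨C', hC'⟩, h2'⟩
    rcases lt_trichotomy l l' with h | h | h
    · exact absurd (tdnPhi_attains F T l' l x h C hC) h2'
    · exact h
    · exact absurd (tdnPhi_attains F T l l' x h C' hC') h2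
  have hcount : (⋃ x, Bad x).Countable := Set.countable_iUnion fun x => (hsub x).countable
  have hnot : ¬ (Set.Ioo (0 : ℝ) 1).Countable := by
    intro h
    have := Cardinal.mk_Ioo_real (zero_lt_one' ℝ)
    have h' := Cardinal.le_aleph0_iff_set_countable.2 h
    rw [this] at h'
    exact absurd h' (not_le.2 Cardinal.aleph0_lt_continuum)
  obtain ⟨l, hl, hl'⟩ : ∃ l ∈ Set.Ioo (0 : ℝ) 1, l ∉ ⋃ x, Bad x := by
    by_contra hcon
    push Not at hcon
    exact hnot (hcount.mono hcon)
  refine ⟨l, hl.1, hl.2, fun x hx => ?_⟩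
  by_contra hcon
  exact hl' (Set.mem_iUnion.2 ⟨x, hx, hcon⟩)

lemma tdn_lin_unbounded (A B C : ℝ) (hB : 0 < B) (h : ∀ t : ℝ, 0 ≤ t → A + B * t ≤ C) : False := by
  have h0 := h 0 le_rfl
  have h1 := h ((C - A + 1) / B) (div_nonneg (by linarith) hB.le)
  rw [mul_div_cancel₀ _ hB.ne'] at h1
  linarith

lemma tdn_eval_single {n : ℕ} (f : TropPoly n) (D : ℕ) (hD : ∀ I ∈ f.supp, ∀ i, I i ≤ D)
    (i : Fin n) (t : ℝ) :
    f.supp.inf' f.supp_nonempty f.coeff + D * min t 0 ≤ f.eval (Pi.single i t) := by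
  refine Finset.le_inf' _ _ fun I hI => ?_
  rw [tdn_mono_eq, tdnPair_single]
  have h1 : f.supp.inf' f.supp_nonempty f.coeff ≤ f.coeff I := Finset.inf'_le _ hI
  have h2 : ((I i : ℕ) : ℝ) ≤ D := by exact_mod_cast hD I hI i
  have h3 : (0 : ℝ) ≤ I i := by positivity
  rcases le_total t 0 with ht | ht
  · rw [min_eq_left ht]; nlinarith
  · rw [min_eq_right ht]; nlinarith

lemma tdnPhi_single {n k : ℕ} (F : Fin k → TropPoly n) (D : ℕ)
    (hD : ∀ j, ∀ I ∈ (F j).supp, ∀ i, I i ≤ D) (T : Exp n) (l : ℝ) (hl : 0 ≤ l) (x : Exp n)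
    (i : Fin n) (t : ℝ) :
    (∑ j, (F j).supp.inf' (F j).supp_nonempty (F j).coeff) + k * (D * min t 0) + T i * t
      - l * (n + |t|) - x i * t ≤ tdnPhi F T l x (Pi.single i t) := by
  have h1 := Finset.sum_le_sum fun j (_ : j ∈ Finset.univ) =>
    tdn_eval_single (F j) D (hD j) i t
  rw [Finset.sum_add_distrib] at h1
  simp only [Finset.sum_const, Finset.card_univ, Fintype.card_fin, nsmul_eq_mul] at h1
  have h2 := mul_le_mul_of_nonneg_left (tdnS_single i t) hl
  unfold tdnPhi
  rw [tdnPair_single, tdnPair_single]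
  linarith

lemma tdn_bounds {n k : ℕ} (F : Fin k → TropPoly n) (D : ℕ)
    (hD : ∀ j, ∀ I ∈ (F j).supp, ∀ i, I i ≤ D) (l : ℝ) (hl : 0 < l) (hl1 : l < 1) (x : Exp n)
    (C : ℝ) (hC : ∀ a, tdnPhi F (fun _ => D + 1) l x a ≤ C) (i : Fin n) :
    D ≤ x i ∧ x i ≤ k * D + D + 3 := by
  constructor
  · by_contra! hlt
    have hx : (x i : ℝ) ≤ D := by exact_mod_cast hlt.le
    refine tdn_lin_unbounded ((∑ j, (F j).supp.inf' (F j).supp_nonempty (F j).coeff) - l * n)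
      (1 - l) C (by linarith) fun t ht => ?_
    have := (tdnPhi_single F D hD (fun _ => D + 1) l hl.le x i t).trans (hC _)
    rw [min_eq_right ht, abs_of_nonneg ht] at this
    push_cast at this
    nlinarith
  · by_contra! hlt
    have hx : (k * D + D + 3 : ℝ) ≤ x i := by exact_mod_cast hlt.le
    refine tdn_lin_unbounded ((∑ j, (F j).supp.inf' (F j).supp_nonempty (F j).coeff) - l * n)
      1 C one_pos fun t ht => ?_
    have := (tdnPhi_single F D hD (fun _ => D + 1) l hl.le x i (-t)).trans (hC _)
    rw [min_eq_left (by linarith), abs_neg, abs_of_nonneg ht] at this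
    push_cast at this
    nlinarith

lemma tdn_nonempty {n k : ℕ} (F : Fin k → TropPoly n) (T : Exp n) (l : ℝ) (hl : 0 < l) :
    ∃ x : Exp n, ∃ C, ∀ a, tdnPhi F T l x a ≤ C := by
  choose I hI using fun j => (F j).supp_nonempty
  refine ⟨T + ∑ j, I j, ∑ j, (F j).coeff (I j), fun a => ?_⟩
  have h1 := Finset.sum_le_sum fun j (_ : j ∈ Finset.univ) => tdn_eval_le (F j) (hI j) a
  simp only [tdn_mono_eq, Finset.sum_add_distrib] at h1
  have h2 : tdnPair (∑ j, I j) a = ∑ j, tdnPair (I j) a := by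
    simp only [tdnPair, Finset.sum_apply, Nat.cast_sum, Finset.sum_mul]
    exact Finset.sum_comm
  have h3 := mul_nonneg hl.le (tdnS_nonneg a)
  unfold tdnPhi
  rw [tdnPair_add, h2]
  linarith

/-- The key strict inequality. -/
lemma tdn_key {n k : ℕ} (F : Fin k → TropPoly n) (T : Exp n) (l : ℝ) (hl : 0 < l)
    (hgood : ∀ x : Exp n, (∃ C, ∀ a, tdnPhi F T l x a ≤ C) →
      ∃ a, ∀ b, tdnPhi F T l x b ≤ tdnPhi F T l x a)
    (J : Exp n) (j : Fin k) (I : Exp n) (hI : I ∈ (F j).supp) (a : Fin n → ℝ)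
    (hmax : ∀ b, tdnPhi F T l (J + I) b ≤ tdnPhi F T l (J + I) a)
    (huniq : ∀ I' ∈ (F j).supp, I' ≠ I → (F j).mono I a < (F j).mono I' a)
    (I' : Exp n) (hI' : I' ∈ (F j).supp) (hne : I' ≠ I) :
    ∃ a₁, (∀ b, tdnPhi F T l (J + I') b ≤ tdnPhi F T l (J + I') a₁) ∧
      tdnPhi F T l (J + I') a₁ <
        tdnPhi F T l (J + I) a + (F j).coeff I' - (F j).coeff I := by
  let Psi : (Fin n → ℝ) → ℝ := fun b =>
    tdnPhi F T l (J + I) b - (F j).eval b + (F j).mono I b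
  have hPsi : ∀ b, Psi b = (∑ i ∈ Finset.univ.erase j, (F i).eval b) + tdnPair T b - l * tdnS b
      - tdnPair J b + (F j).coeff I := by
    intro b
    have := Finset.sum_erase_add Finset.univ (fun i => (F i).eval b) (Finset.mem_univ j)
    simp only [Psi, tdnPhi, tdn_mono_eq, tdnPair_add]
    linarith
  have hconc : StrictConcaveOn ℝ Set.univ Psi := by
    refine ⟨convex_univ, ?_⟩
    intro b _ c _ hbc α β hα hβ h
    have h1 := tdnS_strictConvex.2 (Set.mem_univ b) (Set.mem_univ c) hbc hα hβ h
    have h2 := Finset.sum_le_sum fun i (_ : i ∈ Finset.univ.erase j) =>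
      tdn_eval_concave (F i) b c α β hα.le hβ.le h
    rw [Finset.sum_add_distrib, ← Finset.mul_sum, ← Finset.mul_sum] at h2
    have h3 := mul_lt_mul_of_pos_left h1 hl
    have h4 : (F j).coeff I = α * (F j).coeff I + β * (F j).coeff I := by
      rw [← add_mul, h, one_mul]
    simp only [smul_eq_mul] at h3 ⊢
    rw [hPsi, hPsi, hPsi, tdnPair_comb, tdnPair_comb]
    nlinarith
  have hloc : IsLocalMax Psi a := by
    have h1 : ∀ I'' ∈ (F j).supp, ∀ᶠ b in nhds a, (F j).mono I b ≤ (F j).mono I'' b := by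
      intro I'' hI''
      by_cases h : I'' = I
      · subst h; exact Filter.Eventually.of_forall fun _ => le_rfl
      · filter_upwards [(tdn_mono_continuous (F j) I).continuousAt.eventually_lt
          (tdn_mono_continuous (F j) I'').continuousAt (huniq I'' hI'' h)] with b hb
        exact hb.le
    have h2 := (Filter.eventually_all_finset (F j).supp).2 h1
    filter_upwards [h2] with b hb
    have h3 : (F j).mono I b ≤ (F j).eval b := Finset.le_inf' _ _ hb
    have h4 := hmax b
    have h5 := tdn_eval_le (F j) hI a
    simp only [Psi]
    linarith
  have hglob : ∀ b, Psi b ≤ Psi a := IsMaxOn.of_isLocalMax_of_convex_univ hloc hconc.concaveOn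
  have hPa : Psi a = tdnPhi F T l (J + I) a := by
    have h3 : (F j).mono I a ≤ (F j).eval a := by
      refine Finset.le_inf' _ _ fun I'' hI'' => ?_
      by_cases h : I'' = I
      · rw [h]
      · exact (huniq I'' hI'' h).le
    have h5 := tdn_eval_le (F j) hI a
    simp only [Psi]
    linarith
  have hrel : ∀ b, tdnPhi F T l (J + I') b =
      Psi b + ((F j).eval b - (F j).mono I' b) + (F j).coeff I' - (F j).coeff I := by
    intro b
    simp only [Psi, tdnPhi, tdn_mono_eq, tdnPair_add]
    ring
  obtain ⟨a₁, ha₁⟩ := hgood (J + I') ⟨Psi a + (F j).coeff I' - (F j).coeff I, fun b => by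
    have h1 := hglob b
    have h2 := tdn_eval_le (F j) hI' b
    rw [hrel]; linarith⟩
  refine ⟨a₁, ha₁, ?_⟩
  rw [← hPa, hrel]
  have h2 := tdn_eval_le (F j) hI' a₁
  by_cases h : a₁ = a
  · subst h
    have h3 := huniq I' hI' hne
    have h4 := tdn_eval_le (F j) hI a₁
    linarith
  · have h1 : Psi a₁ < Psi a := by
      refine lt_of_le_of_ne (hglob a₁) fun he => h ?_
      refine hconc.eq_of_isMaxOn (fun b _ => ?_) (fun b _ => hglob b) (Set.mem_univ _)
        (Set.mem_univ _)
      simp only [Set.mem_ofPred_eq]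
      rw [he]; exact hglob b
    linarith

lemma tdn_not_root {n : ℕ} (f : TropPoly n) (a : Fin n → ℝ) (h : ¬ f.IsRoot a) :
    ∃ I ∈ f.supp, ∀ I' ∈ f.supp, I' ≠ I → f.mono I a < f.mono I' a := by
  obtain ⟨I, hI, he⟩ := Finset.exists_mem_eq_inf' f.supp_nonempty (fun I => f.mono I a)
  refine ⟨I, hI, fun I' hI' hne => ?_⟩
  have he' : f.mono I a = f.eval a := he.symm
  refine lt_of_le_of_ne (he' ▸ tdn_eval_le f hI' a) fun heq => h ?_
  exact ⟨I, hI, I', hI', hne.symm, he', heq ▸ he'⟩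

lemma tdn_macVal {n : ℕ} (f : TropPoly n) (J I : Exp n) (hI : I ∈ f.supp) (y : Exp n → ℝ) :
    macVal f J (fun I => (y I : WithTop ℝ)) (J + I) = ((f.coeff I + y (J + I) : ℝ) : WithTop ℝ) := by
  have h : J ≤ J + I ∧ J + I - J ∈ f.supp := by
    rw [add_tsub_cancel_left]; exact ⟨le_self_add, hI⟩
  simp only [macVal, shiftCoeff]
  rw [if_pos h, add_tsub_cancel_left, WithTop.coe_add]

lemma tdn_macVal_top {n : ℕ} (f : TropPoly n) (J K : Exp n) (y : Exp n → ℝ)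
    (h : ¬ ∃ I ∈ f.supp, K = J + I) :
    macVal f J (fun I => (y I : WithTop ℝ)) K = ⊤ := by
  have h' : ¬ (J ≤ K ∧ K - J ∈ f.supp) := fun hh =>
    h ⟨K - J, hh.2, (add_tsub_cancel_of_le hh.1).symm⟩
  simp only [macVal, shiftCoeff]
  rw [if_neg h', top_add]

lemma tdn_forward {n k : ℕ} (F : Fin k → TropPoly n) (a : Fin n → ℝ)
    (h : ∀ j, (F j).IsRoot a) : IsInfMacaulaySol F (fun I => tdnPair I a) := by
  intro j J
  obtain ⟨I₁, h1, I₂, h2, hne, e1, e2⟩ := h j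
  refine ⟨J + I₁, J + I₂, fun he => hne (add_left_cancel he), ?_, fun K => ?_⟩
  · rw [tdn_macVal (F j) J I₁ h1 (fun I => tdnPair I a),
      tdn_macVal (F j) J I₂ h2 (fun I => tdnPair I a)]
    rw [tdn_mono_eq] at e1 e2
    congr 1
    rw [tdnPair_add, tdnPair_add]
    linarith
  · by_cases hK : ∃ I ∈ (F j).supp, K = J + I
    · obtain ⟨I, hI, rfl⟩ := hK
      rw [tdn_macVal (F j) J I₁ h1 (fun I => tdnPair I a),
        tdn_macVal (F j) J I hI (fun I => tdnPair I a), WithTop.coe_le_coe]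
      have := tdn_eval_le (F j) hI a
      rw [← e1, tdn_mono_eq, tdn_mono_eq] at this
      rw [tdnPair_add, tdnPair_add]
      linarith
    · rw [tdn_macVal_top (F j) J K (fun I => tdnPair I a) hK]
      exact le_top

lemma tdn_backward {n k : ℕ} (F : Fin k → TropPoly n) (y : Exp n → ℝ)
    (hy : IsInfMacaulaySol F y) : ∃ a : Fin n → ℝ, ∀ j : Fin k, (F j).IsRoot a := by
  by_contra! hno
  obtain ⟨D, hD⟩ : ∃ D : ℕ, ∀ j, ∀ I ∈ (F j).supp, ∀ i, I i ≤ D := by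
    refine ⟨Finset.univ.sup fun j => (F j).supp.sup fun I => Finset.univ.sup fun i => I i,
      fun j I hI i => ?_⟩
    calc I i ≤ Finset.univ.sup fun i => I i := Finset.le_sup (f := fun i => I i) (Finset.mem_univ i)
      _ ≤ (F j).supp.sup fun I => Finset.univ.sup fun i => I i :=
        Finset.le_sup (f := fun I : Exp n => Finset.univ.sup fun i => I i) hI
      _ ≤ _ := Finset.le_sup (f := fun j => (F j).supp.sup fun I => Finset.univ.sup fun i => I i)
        (Finset.mem_univ j)
  let T : Exp n := fun _ => D + 1
  obtain ⟨l, hl, hl1, hgood⟩ := tdn_good F T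
  let S : Set (Exp n) := {x | ∃ C, ∀ a, tdnPhi F T l x a ≤ C}
  have hSfin : S.Finite := by
    refine (Set.finite_Iic (fun _ => k * D + D + 3 : Exp n)).subset ?_
    rintro x ⟨C, hC⟩ i
    exact (tdn_bounds F D hD l hl hl1 x C hC i).2
  have hSne : S.Nonempty := tdn_nonempty F T l hl
  have hch : ∀ x : Exp n, ∃ a, x ∈ S → ∀ b, tdnPhi F T l x b ≤ tdnPhi F T l x a := by
    intro x
    by_cases hx : x ∈ S
    · obtain ⟨a, ha⟩ := hgood x hx
      exact ⟨a, fun _ => ha⟩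
    · exact ⟨0, fun h => absurd h hx⟩
  choose A hA using hch
  obtain ⟨x₀, hx₀, hmin⟩ := Set.exists_min_image S (fun x => y x + tdnPhi F T l x (A x)) hSfin hSne
  obtain ⟨j, hj⟩ := hno (A x₀)
  obtain ⟨I, hI, huniq⟩ := tdn_not_root (F j) (A x₀) hj
  obtain ⟨C, hC⟩ := id hx₀
  have hle : I ≤ x₀ := fun i => (hD j I hI i).trans (tdn_bounds F D hD l hl hl1 x₀ C hC i).1
  obtain ⟨J, rfl⟩ : ∃ J, x₀ = J + I := ⟨x₀ - I, (tsub_add_cancel_of_le hle).symm⟩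
  have hstrict : ∀ I' ∈ (F j).supp, I' ≠ I →
      (F j).coeff I + y (J + I) < (F j).coeff I' + y (J + I') := by
    intro I' hI' hne
    obtain ⟨a₁, h1, h2⟩ := tdn_key F T l hl hgood J j I hI (A (J + I)) (hA _ hx₀) huniq I' hI' hne
    have hS' : J + I' ∈ S := ⟨_, h1⟩
    have h3 := hmin _ hS'
    have h4 := h1 (A (J + I'))
    linarith
  obtain ⟨K₁, K₂, hne, he, hall⟩ := hy j J
  have hone : ∀ K, (∀ K', macVal (F j) J (fun I => (y I : WithTop ℝ)) K ≤
      macVal (F j) J (fun I => (y I : WithTop ℝ)) K') → K = J + I := by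
    intro K hK
    have h1 := hK (J + I)
    rw [tdn_macVal (F j) J I hI y] at h1
    by_cases hex : ∃ I' ∈ (F j).supp, K = J + I'
    · obtain ⟨I', hI', rfl⟩ := hex
      rw [tdn_macVal (F j) J I' hI' y, WithTop.coe_le_coe] at h1
      by_contra hcon
      exact absurd (hstrict I' hI' fun h => hcon (by rw [h])) (not_lt.2 h1)
    · rw [tdn_macVal_top (F j) J K y hex] at h1
      exact absurd h1 (not_le.2 (WithTop.coe_lt_top _))
  exact hne ((hone K₁ hall).trans (hone K₂ fun K' => he ▸ hall K').symm)

/-- **Infinite tropical dual Nullstellensatz over ℝ** : a system `F = {f_1, …, f_k}` of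
tropical polynomials in `n` variables over `ℝ` has a root iff the infinite Macaulay
tropical linear system of `F` has a solution. -/
theorem tropical_dual_nullstellensatz_infinite (n k : ℕ) (hk : 1 ≤ k)
    (F : Fin k → TropPoly n) :
    (∃ a : Fin n → ℝ, ∀ j : Fin k, (F j).IsRoot a) ↔
      (∃ y : Exp n → ℝ, IsInfMacaulaySol F y) := by
  exact ⟨fun ⟨a, ha⟩ => ⟨_, tdn_forward F a ha⟩, fun ⟨y, hy⟩ => tdn_backward F y hy⟩
end
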